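/- Existence of a constrained minimizer when 0 < k₁₂ < 1: assume p > q > 0 (so 0 < k₁₂ = (p−q)/p < 1), α > 0 and β > (α/4)(p/q + q/p − 2). Then the constrained minimization problem min{ I(ξ,ζ) : (ξ,ζ) ∈ 𝒜 } has a solution, i.e. there exists (ξ,ζ) ∈ 𝒜 with I(ξ,ζ) = inf_{(φ,ψ)∈𝒜} I(φ,ψ). -/

import Mathlib

noncomputable section

open MeasureTheory Real Filter Topology
open scoped ENNReal

abbrev Plane : Type := EuclideanSpace ℝ (Fin 2)

/-- The weighted measure dμ = h₀ dx on the plane. -/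
def wMeasure (h₀ : Plane → ℝ) : Measure Plane :=
  volume.withDensity fun x => ENNReal.ofReal (h₀ x)

/-- Membership in the weighted Sobolev space 𝓗 : the (distributional) gradient is
square integrable with respect to Lebesgue measure and the function itself is square
integrable with respect to the weighted measure dμ. -/
def MemH (h₀ : Plane → ℝ) (u : Plane → ℝ) : Prop :=
  Differentiable ℝ u ∧
    Integrable (fun x => ‖gradient u x‖ ^ 2) volume ∧
    Integrable (fun x => u x ^ 2) (wMeasure h₀)

/-- Membership in 𝓗̃, the subspace of 𝓗 of functions with zero dμ-mean. -/
def MemHt (h₀ : Plane → ℝ) (u : Plane → ℝ) : Prop :=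
  MemH h₀ u ∧ ∫ x, u x ∂(wMeasure h₀) = 0

/-- The squared 𝓗-norm: ‖u‖²_𝓗 = ‖∇u‖²_{L²(dx)} + ‖u‖²_{L²(dμ)}. -/
def HnormSq (h₀ : Plane → ℝ) (u : Plane → ℝ) : ℝ :=
  (∫ x, ‖gradient u x‖ ^ 2) + ∫ x, u x ^ 2 ∂(wMeasure h₀)

/-- The 𝓗-norm. -/
def Hnorm (h₀ : Plane → ℝ) (u : Plane → ℝ) : ℝ :=
  Real.sqrt (HnormSq h₀ u)

/-- The entry k₁₁ = (p+q)/p of the coupling matrix. -/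
def k11 (p q : ℝ) : ℝ := (p + q) / p

/-- The entry k₁₂ = (p−q)/p of the coupling matrix. -/
def k12 (p q : ℝ) : ℝ := (p - q) / p

/-- The determinant |K| = 4q/p of the coupling matrix. -/
def Kdet (p q : ℝ) : ℝ := 4 * q / p

/-- The action functional I(ξ,ζ) (with σ = |K|/k₁₂²). -/
def Ifun (p q : ℝ) (f h : Plane → ℝ) (ξ ζ : Plane → ℝ) : ℝ :=
  ∫ x, ((1 : ℝ) / 2 * ‖gradient ξ x‖ ^ 2
      + Kdet p q / (2 * k12 p q ^ 2) * ‖gradient ζ x‖ ^ 2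
      + f x * ξ x + Kdet p q / k12 p q ^ 2 * h x * ζ x)

/-- The admissible set 𝒜 : pairs in 𝓗 × 𝓗 satisfying the two natural constraints. -/
def Admissible (h₀ : Plane → ℝ) (p q α β : ℝ) (U V : Plane → ℝ)
    (ξ ζ : Plane → ℝ) : Prop :=
  MemH h₀ ξ ∧ MemH h₀ ζ ∧
  Integrable (fun x => V x * Real.exp ((ξ x - ζ x) / 2)) volume ∧
  Integrable (fun x => U x * Real.exp (-(k11 p q / (2 * k12 p q)) * ζ x)) volume ∧
  2 * Kdet p q / k11 p q * (∫ x, V x * Real.exp ((ξ x - ζ x) / 2)) = 2 * π * α ∧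
  2 * k12 p q * (∫ x, U x * Real.exp (-(k11 p q / (2 * k12 p q)) * ζ x))
    + 2 * k12 p q ^ 2 / k11 p q * (∫ x, V x * Real.exp ((ξ x - ζ x) / 2)) = 2 * π * β

section Auxiliary

open scoped ContDiff Convolution NNReal

/-- A smooth cutoff on the line, equal to `1` on `(-∞, 1/3]` and to `0` on `[2/3, ∞)`. -/
def cutoff (s : ℝ) : ℝ := Real.smoothTransition (2 - 3 * s)

lemma contDiff_cutoff : ContDiff ℝ ∞ cutoff :=
  Real.smoothTransition.contDiff.comp (by fun_prop)

lemma cutoff_of_le {s : ℝ} (hs : s ≤ 1 / 3) : cutoff s = 1 :=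
  Real.smoothTransition.one_of_one_le (by linarith)

lemma cutoff_of_ge {s : ℝ} (hs : 2 / 3 ≤ s) : cutoff s = 0 :=
  Real.smoothTransition.zero_of_nonpos (by linarith)

lemma antitone_cutoff : Antitone cutoff := fun a b hab =>
  Real.smoothTransition.monotone (by linarith)

/-- The logarithmic derivative profile `(χ(s) - χ(4s)) / s`. -/
def profileDeriv (s : ℝ) : ℝ := (cutoff s - cutoff (4 * s)) / s

lemma profileDeriv_of_small {s : ℝ} (hs : s < 1 / 12) : profileDeriv s = 0 := by
  rw [profileDeriv, cutoff_of_le (by linarith), cutoff_of_le (by linarith)]; simp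

lemma profileDeriv_of_large {s : ℝ} (hs : 2 / 3 ≤ s) : profileDeriv s = 0 := by
  rw [profileDeriv, cutoff_of_ge (by linarith), cutoff_of_ge (by linarith)]; simp

lemma mul_profileDeriv (s : ℝ) : s * profileDeriv s = cutoff s - cutoff (4 * s) := by
  rcases eq_or_ne s 0 with rfl | h
  · simp
  · rw [profileDeriv]; field_simp

lemma profileDeriv_nonneg (s : ℝ) : 0 ≤ profileDeriv s := by
  rcases lt_or_ge s (1 / 12) with h | h
  · rw [profileDeriv_of_small h]
  · exact div_nonneg (sub_nonneg.2 (antitone_cutoff (by linarith))) (by linarith)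

lemma contDiff_profileDeriv : ContDiff ℝ ∞ profileDeriv := by
  rw [contDiff_iff_contDiffAt]
  intro s
  rcases lt_or_ge s (1 / 12) with h | h
  · have : profileDeriv =ᶠ[𝓝 s] fun _ => 0 := by
      filter_upwards [gt_mem_nhds h] with t ht using profileDeriv_of_small ht
    exact contDiffAt_const.congr_of_eventuallyEq this
  · refine ContDiffAt.div ?_ contDiffAt_id (by simp; linarith)
    exact (contDiff_cutoff.sub (contDiff_cutoff.comp (by fun_prop))).contDiffAt

/-- The nonpositive radial profile of the building block of the logarithmic kernel. -/
def profile (s : ℝ) : ℝ := ∫ t in (1 : ℝ)..s, profileDeriv t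

lemma hasDerivAt_profile (s : ℝ) : HasDerivAt profile (profileDeriv s) s :=
  (contDiff_profileDeriv.continuous).integral_hasStrictDerivAt 1 s |>.hasDerivAt

lemma contDiff_profile : ContDiff ℝ ∞ profile := by
  rw [contDiff_infty_iff_deriv]
  refine ⟨fun s => (hasDerivAt_profile s).differentiableAt, ?_⟩
  rw [show deriv profile = profileDeriv from funext fun s => (hasDerivAt_profile s).deriv]
  exact contDiff_profileDeriv

lemma profile_of_ge {s : ℝ} (hs : 1 ≤ s) : profile s = 0 := by
  rw [profile, intervalIntegral.integral_congr (g := fun _ => 0)]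
  · simp
  · intro t ht
    rw [Set.uIcc_of_le hs] at ht
    exact profileDeriv_of_large (by linarith [ht.1])

lemma profile_nonpos (s : ℝ) : profile s ≤ 0 := by
  rcases le_total 1 s with h | h
  · exact (profile_of_ge h).le
  · rw [profile, intervalIntegral.integral_symm, neg_nonpos]
    exact intervalIntegral.integral_nonneg h fun t _ => profileDeriv_nonneg t

/-- The standard unit vectors of the plane. -/
abbrev unitVec (i : Fin 2) : Plane := EuclideanSpace.single i 1

/-- A smooth compactly supported function whose Laplacian is the difference of two consecutive
dyadic rescalings of a smooth probability density. -/
structure DyadicKernel where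
  Φ : Plane → ℝ
  ρ : Plane → ℝ
  contDiff_Φ : ContDiff ℝ ∞ Φ
  contDiff_ρ : ContDiff ℝ ∞ ρ
  Φ_eq_zero : ∀ x, 1 ≤ ‖x‖ → Φ x = 0
  ρ_eq_zero : ∀ x, 1 ≤ ‖x‖ → ρ x = 0
  Φ_nonpos : ∀ x, Φ x ≤ 0
  ρ_nonneg : ∀ x, 0 ≤ ρ x
  integral_ρ : ∫ x, ρ x = 1
  laplacian : ∀ x, ∑ i, fderiv ℝ (fun y => fderiv ℝ Φ y (unitVec i)) x (unitVec i)
    = 4 * ρ ((2 : ℝ) • x) - ρ x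

lemma hasFDerivAt_comp_norm_sq {g : ℝ → ℝ} {g' : ℝ} {x : Plane}
    (hg : HasDerivAt g g' (‖x‖ ^ 2)) :
    HasFDerivAt (fun y : Plane => g (‖y‖ ^ 2)) ((2 * g') • innerSL ℝ x) x := by
  have h1 : HasFDerivAt (fun y : Plane => ‖y‖ ^ 2) (2 • innerSL ℝ x) x :=
    (hasStrictFDerivAt_norm_sq x).hasFDerivAt
  convert! hg.comp_hasFDerivAt x h1 using 1
  ext v
  simp; ring

lemma hasCompactSupport_of_norm {g : Plane → ℝ} (hg : ∀ x, 1 ≤ ‖x‖ → g x = 0) :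
    HasCompactSupport g :=
  HasCompactSupport.intro (isCompact_closedBall (0 : Plane) 1) fun x hx =>
    hg x (by simp at hx; exact hx.le)

theorem DyadicKernel.nonempty : Nonempty DyadicKernel := by
  set θ : Plane → ℝ := fun x => -4 * deriv cutoff (‖x‖ ^ 2) with hθ
  have hdc : ContDiff ℝ ∞ (deriv cutoff) := (contDiff_infty_iff_deriv.1 contDiff_cutoff).2
  have hnsq : ContDiff ℝ ∞ fun x : Plane => ‖x‖ ^ 2 := contDiff_norm_sq ℝ
  have hθs : ContDiff ℝ ∞ θ := contDiff_const.mul (hdc.comp hnsq)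
  have hd0 : ∀ s, 1 ≤ s → deriv cutoff s = 0 := fun s hs => by
    have : cutoff =ᶠ[𝓝 s] fun _ => 0 := by
      filter_upwards [lt_mem_nhds (show (2 / 3 : ℝ) < s by linarith)] with t ht
        using cutoff_of_ge ht.le
    rw [this.deriv_eq]; simp
  have hθ0 : ∀ x, 1 ≤ ‖x‖ → θ x = 0 := fun x hx => by
    simp [hθ, hd0 _ (show (1 : ℝ) ≤ ‖x‖ ^ 2 by nlinarith)]
  have hθn : ∀ x, 0 ≤ θ x := fun x => by
    have : deriv cutoff (‖x‖ ^ 2) ≤ 0 := antitone_cutoff.deriv_nonpos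
    simp only [hθ]; linarith
  have hpos : 0 < ∫ x, θ x := by
    obtain ⟨s, hs, hs'⟩ : ∃ s ∈ Set.Ioo (0 : ℝ) 1, deriv cutoff s = (cutoff 1 - cutoff 0) / (1 - 0) :=
      exists_deriv_eq_slope _ (by norm_num) contDiff_cutoff.continuous.continuousOn
        (contDiff_cutoff.differentiable (by simp)).differentiableOn
    rw [cutoff_of_ge (by norm_num), cutoff_of_le (by norm_num)] at hs'
    refine hθs.continuous.integral_pos_of_hasCompactSupport_nonneg_nonzero
      (hasCompactSupport_of_norm hθ0) hθn (x := (Real.sqrt s) • unitVec 0) ?_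
    have : ‖(Real.sqrt s) • unitVec 0‖ ^ 2 = s := by
      rw [norm_smul, mul_pow]; simp [Real.sq_sqrt hs.1.le]
    simp only [hθ, this, hs']; norm_num
  set c : ℝ := (∫ x, θ x)⁻¹ with hc
  have hc0 : 0 < c := inv_pos.2 hpos
  refine ⟨⟨fun x => c * profile (‖x‖ ^ 2), fun x => c * θ x,
    contDiff_const.mul (contDiff_profile.comp hnsq), contDiff_const.mul hθs, ?_, ?_, ?_, ?_, ?_, ?_⟩⟩
  · intro x hx; simp only [profile_of_ge (show (1 : ℝ) ≤ ‖x‖ ^ 2 by nlinarith), mul_zero]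
  · intro x hx; simp only [hθ0 x hx, mul_zero]
  · intro x; exact mul_nonpos_of_nonneg_of_nonpos hc0.le (profile_nonpos _)
  · intro x; exact mul_nonneg hc0.le (hθn x)
  · rw [integral_const_mul, hc, inv_mul_cancel₀ hpos.ne']
  · intro x
    have h1 : ∀ i, (fun y => fderiv ℝ (fun x : Plane => c * profile (‖x‖ ^ 2)) y (unitVec i))
        = fun y => 2 * c * (profileDeriv (‖y‖ ^ 2) * y i) := fun i => by
      funext y
      rw [((hasFDerivAt_comp_norm_sq (hasDerivAt_profile _)).const_mul c).fderiv]
      simp [EuclideanSpace.inner_single_right]; ring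
    have hdp : DifferentiableAt ℝ profileDeriv (‖x‖ ^ 2) :=
      (contDiff_profileDeriv.differentiable (by simp)).differentiableAt
    have h2 : ∀ i, fderiv ℝ (fun y : Plane => 2 * c * (profileDeriv (‖y‖ ^ 2) * y i)) x (unitVec i)
        = 2 * c * (profileDeriv (‖x‖ ^ 2) + 2 * (deriv profileDeriv (‖x‖ ^ 2)) * x i ^ 2) := fun i => by
      have h3 : HasFDerivAt (fun y : Plane => y i) (EuclideanSpace.proj i : Plane →L[ℝ] ℝ) x :=
        (EuclideanSpace.proj i : Plane →L[ℝ] ℝ).hasFDerivAt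
      have h4 : HasFDerivAt (fun y : Plane => 2 * c * (profileDeriv (‖y‖ ^ 2) * y i)) _ x :=
        ((hasFDerivAt_comp_norm_sq hdp.hasDerivAt).mul h3).const_mul (2 * c)
      rw [h4.fderiv]
      simp [EuclideanSpace.inner_single_right]; ring
    have h4 : profileDeriv (‖x‖ ^ 2) + ‖x‖ ^ 2 * deriv profileDeriv (‖x‖ ^ 2)
        = deriv cutoff (‖x‖ ^ 2) - 4 * deriv cutoff (4 * ‖x‖ ^ 2) := by
      have hL : HasDerivAt (fun s => s * profileDeriv s)
          (1 * profileDeriv (‖x‖ ^ 2) + ‖x‖ ^ 2 * deriv profileDeriv (‖x‖ ^ 2)) (‖x‖ ^ 2) :=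
        (hasDerivAt_id _).mul hdp.hasDerivAt
      have hcd := contDiff_cutoff.differentiable (by simp)
      have hR : HasDerivAt (fun s => cutoff s - cutoff (4 * s))
          (deriv cutoff (‖x‖ ^ 2) - deriv cutoff (4 * ‖x‖ ^ 2) * (4 * 1)) (‖x‖ ^ 2) :=
        (hcd _).hasDerivAt.sub ((hcd (4 * ‖x‖ ^ 2)).hasDerivAt.comp (‖x‖ ^ 2)
          ((hasDerivAt_id (‖x‖ ^ 2)).const_mul 4))
      rw [show (fun s => s * profileDeriv s) = fun s => cutoff s - cutoff (4 * s) from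
        funext mul_profileDeriv] at hL
      have := hL.unique hR
      linarith
    have h5 : ‖(2 : ℝ) • x‖ ^ 2 = 4 * ‖x‖ ^ 2 := by rw [norm_smul, mul_pow]; norm_num
    have h6 : ‖x‖ ^ 2 = x 0 ^ 2 + x 1 ^ 2 := by
      rw [EuclideanSpace.norm_sq_eq]; simp
    simp only [h1, h2, hθ, Fin.sum_univ_two, h5]
    linear_combination (4 * c) * h4 - 4 * c * deriv profileDeriv (‖x‖ ^ 2) * h6

/-- `W` is the distributional gradient of `u`. -/
def IsWeakGrad (u : Plane → ℝ) (W : Plane → Plane) : Prop :=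
  ∀ φ : Plane → ℝ, ContDiff ℝ ∞ φ → HasCompactSupport φ → ∀ v : Plane,
    ∫ x, u x * fderiv ℝ φ x v = -∫ x, φ x * inner ℝ (W x) v

lemma integrable_mul_of_hasCompactSupport {u φ : Plane → ℝ} (hu : LocallyIntegrable u)
    (hφ : Continuous φ) (hφs : HasCompactSupport φ) : Integrable fun x => u x * φ x := by
  simpa only [smul_eq_mul, mul_comm] using hu.integrable_smul_left_of_hasCompactSupport hφ hφs

lemma integrable_inner_of_hasCompactSupport {W : Plane → Plane} {φ : Plane → ℝ}
    (hW : LocallyIntegrable W) (hφ : Continuous φ) (hφs : HasCompactSupport φ) (v : Plane) :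
    Integrable fun x => φ x * inner ℝ (W x) v := by
  have := (hW.integrable_smul_left_of_hasCompactSupport hφ hφs).inner_const (𝕜 := ℝ) v
  simpa only [inner_smul_left, RCLike.conj_to_real] using this

lemma clm_apply_eq_sum (L : Plane →L[ℝ] ℝ) (w : Plane) :
    L w = ∑ i, L (unitVec i) * inner ℝ w (unitVec i) := by
  have : w = ∑ i, (inner ℝ w (unitVec i)) • unitVec i := by
    ext j
    fin_cases j <;> simp [EuclideanSpace.inner_single_right, Fin.sum_univ_two]
  conv_lhs => rw [this]
  simp [mul_comm]

lemma hasCompactSupport_comp_sub {φ : Plane → ℝ} (hφ : HasCompactSupport φ) (x : Plane) :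
    HasCompactSupport fun y => φ (x - y) :=
  hφ.comp_homeomorph (Homeomorph.subLeft x)

lemma fderiv_apply_comp_sub (φ : Plane → ℝ) (x y v : Plane) :
    fderiv ℝ (fun y => φ (x - y)) y v = -fderiv ℝ φ (x - y) v := by
  have h1 : (fun y => φ (x - y)) = fun y => (fun z => φ (x + z)) ((-1 : ℝ) • y) := by
    simp [sub_eq_add_neg]
  rw [h1, fderiv_comp_smul (f := fun z => φ (x + z)), fderiv_comp_add_left]
  simp [sub_eq_add_neg]

namespace DyadicKernel

variable (K : DyadicKernel)

/-- The dyadic dilates of the potential `Φ`. -/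
def pot (j : ℕ) (x : Plane) : ℝ := K.Φ ((2 : ℝ) ^ j • x)

/-- The mass-preserving dyadic dilates of the density `ρ`. -/
def dens (j : ℕ) (x : Plane) : ℝ := 4 ^ j * K.ρ ((2 : ℝ) ^ j • x)

lemma norm_two_pow_smul (j : ℕ) (x : Plane) : ‖(2 : ℝ) ^ j • x‖ = 2 ^ j * ‖x‖ := by
  rw [norm_smul]; simp

lemma le_norm_two_pow_smul (j : ℕ) {x : Plane} (hx : 1 ≤ ‖x‖) : 1 ≤ ‖(2 : ℝ) ^ j • x‖ := by
  rw [norm_two_pow_smul]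
  exact one_le_mul_of_one_le_of_one_le (one_le_pow₀ one_le_two) hx

lemma contDiff_pot (j : ℕ) : ContDiff ℝ ∞ (K.pot j) :=
  K.contDiff_Φ.comp (contDiff_const_smul _)

lemma contDiff_dens (j : ℕ) : ContDiff ℝ ∞ (K.dens j) :=
  contDiff_const.mul (K.contDiff_ρ.comp (contDiff_const_smul _))

lemma pot_eq_zero (j : ℕ) {x : Plane} (hx : 1 ≤ ‖x‖) : K.pot j x = 0 :=
  K.Φ_eq_zero _ (le_norm_two_pow_smul j hx)

lemma dens_eq_zero (j : ℕ) {x : Plane} (hx : 1 ≤ ‖x‖) : K.dens j x = 0 := by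
  rw [dens, K.ρ_eq_zero _ (le_norm_two_pow_smul j hx), mul_zero]

lemma hasCompactSupport_pot (j : ℕ) : HasCompactSupport (K.pot j) :=
  hasCompactSupport_of_norm fun _ hx => K.pot_eq_zero j hx

lemma hasCompactSupport_dens (j : ℕ) : HasCompactSupport (K.dens j) :=
  hasCompactSupport_of_norm fun _ hx => K.dens_eq_zero j hx

lemma fderiv_pot (j : ℕ) (x : Plane) :
    fderiv ℝ (K.pot j) x = (2 : ℝ) ^ j • fderiv ℝ K.Φ ((2 : ℝ) ^ j • x) :=
  fderiv_comp_smul ..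

lemma laplacian_pot (j : ℕ) (x : Plane) :
    ∑ i, fderiv ℝ (fun y => fderiv ℝ (K.pot j) y (unitVec i)) x (unitVec i)
      = K.dens (j + 1) x - K.dens j x := by
  have h : ∀ i, fderiv ℝ (fun y => fderiv ℝ (K.pot j) y (unitVec i)) x (unitVec i)
      = 4 ^ j * fderiv ℝ (fun y => fderiv ℝ K.Φ y (unitVec i)) ((2 : ℝ) ^ j • x) (unitVec i) := by
    intro i
    have h1 : (fun y => fderiv ℝ (K.pot j) y (unitVec i))
        = fun y => (2 : ℝ) ^ j • (fun z => fderiv ℝ K.Φ z (unitVec i)) ((2 : ℝ) ^ j • y) := by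
      funext y; rw [fderiv_pot]; rfl
    have hd : Differentiable ℝ fun z => fderiv ℝ K.Φ z (unitVec i) := by
      have := (contDiff_infty_iff_fderiv.1 K.contDiff_Φ).2.differentiable (by simp)
      exact this.clm_apply (differentiable_const _)
    have hd' : DifferentiableAt ℝ
        (fun y => (fun z => fderiv ℝ K.Φ z (unitVec i)) ((2 : ℝ) ^ j • y)) x :=
      (hd ((2 : ℝ) ^ j • x)).comp x ((differentiable_id.const_smul ((2 : ℝ) ^ j)) x)
    rw [h1, fderiv_fun_const_smul hd', fderiv_comp_smul (f := fun z => fderiv ℝ K.Φ z (unitVec i))]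
    simp only [FunLike.coe_smul, Pi.smul_apply, smul_eq_mul]
    rw [← mul_assoc, ← mul_pow]; norm_num
  simp only [h, ← Finset.mul_sum, K.laplacian, dens, smul_smul, ← pow_succ']
  ring

lemma conv_dens_succ {u : Plane → ℝ} {W : Plane → Plane} (hu : LocallyIntegrable u)
    (hW : LocallyIntegrable W) (h : IsWeakGrad u W) (j : ℕ) (x : Plane) :
    ∫ y, u y * K.dens (j + 1) (x - y)
      = (∫ y, u y * K.dens j (x - y)) + ∫ y, fderiv ℝ (K.pot j) (x - y) (W y) := by
  have hD : ∀ i, ContDiff ℝ ∞ fun y => fderiv ℝ (K.pot j) y (unitVec i) := fun i =>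
    (contDiff_infty_iff_fderiv.1 (K.contDiff_pot j)).2.clm_apply contDiff_const
  have hDs : ∀ i, HasCompactSupport fun y => fderiv ℝ (K.pot j) y (unitVec i) := fun i =>
    (K.hasCompactSupport_pot j).fderiv_apply (𝕜 := ℝ) (unitVec i)
  have hsub : ContDiff ℝ ∞ fun y : Plane => x - y := contDiff_const.sub contDiff_id
  have key : ∀ i, ∫ y, u y * fderiv ℝ (fun y => fderiv ℝ (K.pot j) y (unitVec i)) (x - y) (unitVec i)
      = ∫ y, fderiv ℝ (K.pot j) (x - y) (unitVec i) * inner ℝ (W y) (unitVec i) := by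
    intro i
    have := h (fun y => fderiv ℝ (K.pot j) (x - y) (unitVec i)) ((hD i).comp hsub)
      (hasCompactSupport_comp_sub (hDs i) x) (unitVec i)
    rw [← neg_eq_iff_eq_neg, ← integral_neg] at this
    rw [← this]
    congr 1; funext y
    rw [fderiv_apply_comp_sub (fun y => fderiv ℝ (K.pot j) y (unitVec i)), mul_neg, neg_neg]
  have hi : ∀ k, Integrable fun y => u y * K.dens k (x - y) := fun k =>
    integrable_mul_of_hasCompactSupport hu ((K.contDiff_dens k).comp hsub).continuous
      (hasCompactSupport_comp_sub (K.hasCompactSupport_dens k) x)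
  rw [← sub_eq_iff_eq_add', ← integral_sub (hi _) (hi _)]
  simp_rw [← mul_sub, ← laplacian_pot, clm_apply_eq_sum (fderiv ℝ (K.pot j) _) (W _),
    Finset.mul_sum]
  rw [integral_finsetSum, integral_finsetSum]
  · exact Finset.sum_congr rfl fun i _ => key i
  · intro i _
    exact integrable_inner_of_hasCompactSupport hW ((hD i).comp hsub).continuous
      (hasCompactSupport_comp_sub (hDs i) x) _
  · intro i _
    refine integrable_mul_of_hasCompactSupport hu ?_ (hasCompactSupport_comp_sub
      (φ := fun z => fderiv ℝ (fun y => fderiv ℝ (K.pot j) y (unitVec i)) z (unitVec i)) ?_ x)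
    · exact (((contDiff_infty_iff_fderiv.1 (hD i)).2.clm_apply contDiff_const).comp hsub).continuous
    · exact (hDs i).fderiv_apply (𝕜 := ℝ) (unitVec i)

lemma conv_dens_eq_sum {u : Plane → ℝ} {W : Plane → Plane} (hu : LocallyIntegrable u)
    (hW : LocallyIntegrable W) (h : IsWeakGrad u W) (n : ℕ) (x : Plane) :
    ∫ y, u y * K.dens n (x - y) = (∫ y, u y * K.dens 0 (x - y))
      + ∑ j ∈ Finset.range n, ∫ y, fderiv ℝ (K.pot j) (x - y) (W y) := by
  induction n with
  | zero => simp
  | succ n ih => rw [K.conv_dens_succ hu hW h, ih, Finset.sum_range_succ]; ring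

lemma integral_comp_two_pow_smul {F : Type*} [NormedAddCommGroup F] [NormedSpace ℝ F]
    (g : Plane → F) (j : ℕ) : ∫ x, g ((2 : ℝ) ^ j • x) = ((1 / 4 : ℝ) ^ j) • ∫ x, g x := by
  rw [Measure.integral_comp_smul]
  congr 1
  rw [finrank_euclideanSpace_fin, ← pow_mul, mul_comm, pow_mul, ← inv_pow, abs_pow]
  norm_num

lemma integral_dens (j : ℕ) : ∫ x, K.dens j x = 1 := by
  simp only [dens]
  rw [integral_const_mul, integral_comp_two_pow_smul, K.integral_ρ, smul_eq_mul, mul_one, ← mul_pow]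
  norm_num

lemma ae_tendsto_conv_dens {u : Plane → ℝ} (hu : LocallyIntegrable u) :
    ∀ᵐ x, Tendsto (fun n => ∫ y, u y * K.dens n (x - y)) atTop (𝓝 (u x)) := by
  obtain ⟨C, hC⟩ := K.contDiff_ρ.continuous.bounded_above_of_compact_support
    (hasCompactSupport_of_norm K.ρ_eq_zero)
  filter_upwards [(Besicovitch.vitaliFamily (volume : Measure Plane)).ae_tendsto_average_norm_sub hu]
    with x hx
  have hr : Tendsto (fun n : ℕ => (1 / 2 : ℝ) ^ n) atTop (𝓝[>] 0) :=
    tendsto_nhdsWithin_iff.2 ⟨tendsto_pow_atTop_nhds_zero_of_lt_one (by norm_num) (by norm_num),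
      Eventually.of_forall fun n => pow_pos (one_half_pos (α := ℝ)) n⟩
  have := (hx.comp (Besicovitch.tendsto_filterAt volume x)).comp hr
  simp_rw [mul_comm (u _), ← smul_eq_mul (K.dens _ _) (u _)]
  refine tendsto_integral_smul_of_tendsto_average_norm_sub
    (C * (volume : Measure Plane).real (Metric.closedBall 0 1)) this ?_ ?_ ?_ ?_
  · exact Eventually.of_forall fun n => hu.integrableOn_isCompact (isCompact_closedBall _ _)
  · refine tendsto_const_nhds.congr fun n => ?_
    rw [integral_sub_left_eq_self (K.dens n), integral_dens]
  · refine Eventually.of_forall fun n y hy => ?_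
    by_contra hyn
    refine hy (?_ : K.dens n (x - y) = 0)
    rw [dens, K.ρ_eq_zero, mul_zero]
    rw [norm_two_pow_smul, ← dist_eq_norm, dist_comm]
    simp only [Metric.mem_closedBall, not_le, one_div, inv_pow] at hyn
    exact (inv_le_iff_one_le_mul₀' (by positivity)).1 hyn.le
  · refine Eventually.of_forall fun n y => ?_
    simp only
    rw [Measure.addHaar_real_closedBall _ _ (by positivity : (0 : ℝ) ≤ (1 / 2) ^ n), finrank_euclideanSpace_fin]
    have hv : 0 < (volume : Measure Plane).real (Metric.ball 0 1) :=
      ENNReal.toReal_pos (Metric.measure_ball_pos _ _ one_pos).ne' measure_ball_lt_top.ne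
    rw [Measure.addHaar_real_closedBall _ _ zero_le_one, finrank_euclideanSpace_fin, dens, abs_mul,
      abs_of_pos (by positivity : (0 : ℝ) < 4 ^ n)]
    have h4 : ((1 / 2 : ℝ) ^ n) ^ 2 = ((4 : ℝ) ^ n)⁻¹ := by
      rw [← pow_mul, mul_comm, pow_mul, ← inv_pow]; norm_num
    rw [h4]
    have : |K.ρ ((2 : ℝ) ^ n • (x - y))| ≤ C := hC _
    field_simp
    simpa using this

end DyadicKernel

lemma lintegral_sq_le_mul {α : Type*} [MeasurableSpace α] (ν : Measure α) {w : α → ℝ≥0∞}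
    (hw : AEMeasurable w ν) : (∫⁻ x, w x ∂ν) ^ 2 ≤ ν Set.univ * ∫⁻ x, w x ^ 2 ∂ν := by
  have h := ENNReal.lintegral_mul_le_Lp_mul_Lq ν Real.HolderConjugate.two_two
    (f := fun _ => 1) aemeasurable_const hw
  simp only [Pi.mul_apply, one_mul, ENNReal.one_rpow, lintegral_const] at h
  calc (∫⁻ x, w x ∂ν) ^ 2 ≤ _ := pow_le_pow_left' h 2
    _ = _ := by
      rw [mul_pow, ← ENNReal.rpow_natCast, ← ENNReal.rpow_natCast, ← ENNReal.rpow_mul,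
        ← ENNReal.rpow_mul]
      norm_num

lemma lintegral_comp_sub_left (Z : Plane → ℝ≥0∞) (x : Plane) : ∫⁻ y, Z (x - y) = ∫⁻ y, Z y :=
  lintegral_sub_left_eq_self Z x

/-- Young's inequality `L¹ * L² → L²`, for nonnegative functions on the plane. -/
lemma lintegral_sq_conv_le {Z w : Plane → ℝ≥0∞} (hZ : Measurable Z) (hw : AEMeasurable w) :
    ∫⁻ x, (∫⁻ y, Z (x - y) * w y) ^ 2 ≤ (∫⁻ z, Z z) ^ 2 * ∫⁻ y, w y ^ 2 := by
  have hZ2 : Measurable fun z : Plane × Plane => Z (z.1 - z.2) :=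
    hZ.comp (measurable_fst.sub measurable_snd)
  have h1 : ∀ x, (∫⁻ y, Z (x - y) * w y) ^ 2 ≤ (∫⁻ z, Z z) * ∫⁻ y, Z (x - y) * w y ^ 2 := by
    intro x
    have hZx : Measurable fun y => Z (x - y) := hZ.comp (measurable_const.sub measurable_id)
    have := lintegral_sq_le_mul (volume.withDensity fun y => Z (x - y))
      (hw.mono_ac (withDensity_absolutelyContinuous _ _))
    rwa [lintegral_withDensity_eq_lintegral_mul₀ hZx.aemeasurable hw,
      lintegral_withDensity_eq_lintegral_mul₀ hZx.aemeasurable (hw.pow_const 2),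
      withDensity_apply _ MeasurableSet.univ, Measure.restrict_univ,
      lintegral_comp_sub_left] at this
  calc ∫⁻ x, (∫⁻ y, Z (x - y) * w y) ^ 2
      ≤ ∫⁻ x, (∫⁻ z, Z z) * ∫⁻ y, Z (x - y) * w y ^ 2 := lintegral_mono h1
    _ = (∫⁻ z, Z z) * ∫⁻ x, ∫⁻ y, Z (x - y) * w y ^ 2 := by
        refine lintegral_const_mul'' _ ?_
        exact (hZ2.aemeasurable.mul ((hw.pow_const 2).comp_snd)).lintegral_prod_right'
    _ = (∫⁻ z, Z z) * ∫⁻ y, ∫⁻ x, Z (x - y) * w y ^ 2 := by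
        congr 1
        exact lintegral_lintegral_swap (hZ2.aemeasurable.mul ((hw.pow_const 2).comp_snd))
    _ = (∫⁻ z, Z z) * ∫⁻ y, (∫⁻ z, Z z) * w y ^ 2 := by
        congr 1
        refine lintegral_congr fun y => ?_
        have hZy : Measurable fun x => Z (x - y) := hZ.comp (measurable_id.sub measurable_const)
        rw [lintegral_mul_const _ hZy, lintegral_sub_right_eq_self Z y]
    _ = (∫⁻ z, Z z) ^ 2 * ∫⁻ y, w y ^ 2 := by
        rw [lintegral_const_mul'' _ (hw.pow_const 2), sq, mul_assoc]

section Convolution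

variable {u k : Plane → ℝ}

lemma integrable_smul_fderiv_comp_sub (hu : LocallyIntegrable u) (hk : ContDiff ℝ 1 k)
    (hks : HasCompactSupport k) (x : Plane) : Integrable fun y => u y • fderiv ℝ k (x - y) := by
  refine hu.integrable_smul_right_of_hasCompactSupport (g := fun y => fderiv ℝ k (x - y)) ?_ ?_
  · exact (hk.continuous_fderiv one_ne_zero).comp (continuous_const.sub continuous_id)
  · exact (hks.fderiv (𝕜 := ℝ)).comp_homeomorph (Homeomorph.subLeft x)

lemma hasFDerivAt_conv (hu : LocallyIntegrable u) (hk : ContDiff ℝ 1 k)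
    (hks : HasCompactSupport k) (x : Plane) :
    HasFDerivAt (fun x => ∫ y, u y * k (x - y)) (∫ y, u y • fderiv ℝ k (x - y)) x :=
  hks.hasFDerivAt_convolution_right (ContinuousLinearMap.mul ℝ ℝ) hu hk x

lemma contDiff_conv (hu : LocallyIntegrable u) (hk : ContDiff ℝ 1 k)
    (hks : HasCompactSupport k) : ContDiff ℝ 1 (fun x => ∫ y, u y * k (x - y)) :=
  hks.contDiff_convolution_right (n := 1) (ContinuousLinearMap.mul ℝ ℝ) hu hk

end Convolution

namespace DyadicKernel

variable (K : DyadicKernel)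

/-- The average of `u` against the reflected density `ρ`. -/
def mean (u : Plane → ℝ) : ℝ := ∫ y, u y * K.dens 0 (0 - y)

/-- The total gradient mass of the dyadic potentials. -/
def gradMass (z : Plane) : ℝ≥0∞ := ∑' j, ‖fderiv ℝ (K.pot j) z‖ₑ

lemma measurable_gradMass : Measurable K.gradMass := by
  refine Measurable.tsum fun j => ?_
  exact ((K.contDiff_pot j).continuous_fderiv (by simp)).enorm.measurable

lemma integral_norm_fderiv_pot (j : ℕ) :
    ∫ z, ‖fderiv ℝ (K.pot j) z‖ = (1 / 2) ^ j * ∫ z, ‖fderiv ℝ K.Φ z‖ := by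
  simp only [fderiv_pot, norm_smul]
  rw [integral_const_mul, integral_comp_two_pow_smul fun z => ‖fderiv ℝ K.Φ z‖, smul_eq_mul,
    ← mul_assoc, norm_pow, ← mul_pow]
  norm_num

lemma integral_norm_pot (j : ℕ) :
    ∫ z, ‖K.pot j z‖ = (1 / 4) ^ j * ∫ z, ‖K.Φ z‖ :=
  integral_comp_two_pow_smul (fun z => ‖K.Φ z‖) j

lemma integrable_norm_fderiv_pot (j : ℕ) : Integrable fun z => fderiv ℝ (K.pot j) z :=
  ((K.contDiff_pot j).continuous_fderiv (by simp)).integrable_of_hasCompactSupport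
    ((K.hasCompactSupport_pot j).fderiv (𝕜 := ℝ))

lemma lintegral_gradMass_lt_top : ∫⁻ z, K.gradMass z < ⊤ := by
  simp only [gradMass]
  rw [lintegral_tsum fun j =>
    ((K.contDiff_pot j).continuous_fderiv (by simp)).enorm.measurable.aemeasurable]
  have : ∀ j, ∫⁻ z, ‖fderiv ℝ (K.pot j) z‖ₑ
      = ENNReal.ofReal ((1 / 2) ^ j * ∫ z, ‖fderiv ℝ K.Φ z‖) := fun j => by
    rw [← integral_norm_fderiv_pot, ofReal_integral_norm_eq_lintegral_enorm
      (K.integrable_norm_fderiv_pot j)]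
  simp_rw [this]
  have hs : Summable fun j : ℕ => (1 / 2 : ℝ) ^ j * ∫ z, ‖fderiv ℝ K.Φ z‖ :=
    (summable_geometric_of_lt_one (by norm_num) (by norm_num)).mul_right _
  rw [← ENNReal.ofReal_tsum_of_nonneg (fun j => by positivity) hs]
  exact ENNReal.ofReal_lt_top

lemma enorm_conv_dens_sub_le {u : Plane → ℝ} {W : Plane → Plane} (hu : LocallyIntegrable u)
    (hW : LocallyIntegrable W) (h : IsWeakGrad u W) (n : ℕ) (x : Plane) :
    ‖(∫ y, u y * K.dens n (x - y)) - ∫ y, u y * K.dens 0 (x - y)‖ₑ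
      ≤ ∫⁻ y, K.gradMass (x - y) * ‖W y‖ₑ := by
  rw [K.conv_dens_eq_sum hu hW h n x, add_sub_cancel_left]
  calc _ ≤ ∑ j ∈ Finset.range n, ‖∫ y, fderiv ℝ (K.pot j) (x - y) (W y)‖ₑ := enorm_sum_le _ _
    _ ≤ ∑ j ∈ Finset.range n, ∫⁻ y, ‖fderiv ℝ (K.pot j) (x - y)‖ₑ * ‖W y‖ₑ := by
        refine Finset.sum_le_sum fun j _ => (enorm_integral_le_lintegral_enorm _).trans ?_
        exact lintegral_mono fun y => ContinuousLinearMap.le_opENorm _ _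
    _ = ∫⁻ y, ∑ j ∈ Finset.range n, ‖fderiv ℝ (K.pot j) (x - y)‖ₑ * ‖W y‖ₑ := by
        rw [lintegral_finsetSum' _ fun j _ => ?_]
        refine AEMeasurable.mul ?_ hW.aestronglyMeasurable.enorm
        exact ((((K.contDiff_pot j).continuous_fderiv (by simp)).comp
          (continuous_const.sub continuous_id)).enorm.measurable).aemeasurable
    _ ≤ _ := by
        refine lintegral_mono fun y => ?_
        rw [← Finset.sum_mul]
        gcongr
        exact ENNReal.sum_le_tsum _

lemma norm_integral_dens_inner_le {W : Plane → Plane} (hW : MemLp W 2) (x v : Plane) :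
    ‖∫ y, K.dens 0 (x - y) * inner ℝ (W y) v‖ ≤
      ((eLpNorm (K.dens 0) 2).toReal * (eLpNorm W 2).toReal) * ‖v‖ := by
  have hd : MemLp (K.dens 0) 2 :=
    (K.contDiff_dens 0).continuous.memLp_of_hasCompactSupport (K.hasCompactSupport_dens 0)
  have hdx : eLpNorm (fun y => K.dens 0 (x - y)) 2 = eLpNorm (K.dens 0) 2 :=
    eLpNorm_comp_measurePreserving hd.1 (Measure.measurePreserving_sub_left volume x)
  have hdxm : MemLp (fun y => K.dens 0 (x - y)) 2 :=
    hd.comp_measurePreserving (Measure.measurePreserving_sub_left volume x)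
  have h1 : ‖∫ y, K.dens 0 (x - y) * inner ℝ (W y) v‖ₑ
      ≤ eLpNorm (fun y => K.dens 0 (x - y)) 2 * eLpNorm W 2 * ‖v‖ₑ := by
    calc _ ≤ ∫⁻ y, ‖K.dens 0 (x - y) * inner ℝ (W y) v‖ₑ := enorm_integral_le_lintegral_enorm _
      _ ≤ ∫⁻ y, ‖K.dens 0 (x - y) • W y‖ₑ * ‖v‖ₑ := by
        refine lintegral_mono fun y => ?_
        rw [enorm_mul, enorm_smul, mul_assoc]
        gcongr
        rw [← ofReal_norm, ← ofReal_norm, ← ofReal_norm, ← ENNReal.ofReal_mul (norm_nonneg _)]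
        exact ENNReal.ofReal_le_ofReal (norm_inner_le_norm _ _)
      _ = (∫⁻ y, ‖K.dens 0 (x - y) • W y‖ₑ) * ‖v‖ₑ := by
        refine lintegral_mul_const'' _ ?_
        exact (hdxm.1.smul hW.1).enorm
      _ ≤ _ := by
        gcongr
        have h3 := eLpNorm_smul_le_mul_eLpNorm (p := 2) (q := 2) (r := 1) (μ := volume)
          (φ := fun y => K.dens 0 (x - y)) (f := W) hW.1 hdxm.1
        rw [eLpNorm_one_eq_lintegral_enorm] at h3
        exact h3
  rw [hdx] at h1
  have h2 := ENNReal.toReal_mono (by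
    exact ENNReal.mul_ne_top (ENNReal.mul_ne_top hd.2.ne hW.2.ne) enorm_ne_top) h1
  simpa [ENNReal.toReal_mul] using h2

lemma norm_conv_dens_sub_mean_le {u : Plane → ℝ} {W : Plane → Plane} (hu : LocallyIntegrable u)
    (hW : MemLp W 2) (h : IsWeakGrad u W) (x : Plane) :
    ‖(∫ y, u y * K.dens 0 (x - y)) - K.mean u‖ ≤
      ((eLpNorm (K.dens 0) 2).toReal * (eLpNorm W 2).toReal) * ‖x‖ := by
  have hk1 : ContDiff ℝ 1 (K.dens 0) := (K.contDiff_dens 0).of_le (by simp)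
  have hks := K.hasCompactSupport_dens 0
  have := convex_univ.norm_image_sub_le_of_norm_hasFDerivWithin_le (𝕜 := ℝ)
    (fun z _ => (hasFDerivAt_conv hu hk1 hks z).hasFDerivWithinAt)
    (C := (eLpNorm (K.dens 0) 2).toReal * (eLpNorm W 2).toReal)
    (fun z _ => ?_) (Set.mem_univ 0) (Set.mem_univ x)
  · simpa [mean] using this
  · refine ContinuousLinearMap.opNorm_le_bound _ (by positivity) fun v => ?_
    rw [ContinuousLinearMap.integral_apply (integrable_smul_fderiv_comp_sub hu hk1 hks z)]
    have h1 := h (fun y => K.dens 0 (z - y)) ((K.contDiff_dens 0).comp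
      (contDiff_const.sub contDiff_id)) (hasCompactSupport_comp_sub hks z) v
    simp_rw [fderiv_apply_comp_sub, mul_neg, integral_neg, neg_inj] at h1
    simp only [FunLike.coe_smul, Pi.smul_apply, smul_eq_mul]
    rw [h1]
    exact K.norm_integral_dens_inner_le hW z v

lemma ae_enorm_sub_mean_le {u : Plane → ℝ} {W : Plane → Plane} (hu : LocallyIntegrable u)
    (hW : MemLp W 2) (h : IsWeakGrad u W) :
    ∀ᵐ x, ‖u x - K.mean u‖ₑ ≤ eLpNorm (K.dens 0) 2 * eLpNorm W 2 * ‖x‖ₑ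
      + ∫⁻ y, K.gradMass (x - y) * ‖W y‖ₑ := by
  have hd : MemLp (K.dens 0) 2 :=
    (K.contDiff_dens 0).continuous.memLp_of_hasCompactSupport (K.hasCompactSupport_dens 0)
  filter_upwards [K.ae_tendsto_conv_dens hu] with x hx
  have hlim : Tendsto (fun n => ‖(∫ y, u y * K.dens n (x - y)) - K.mean u‖ₑ) atTop
      (𝓝 ‖u x - K.mean u‖ₑ) := (hx.sub_const _).enorm
  refine le_of_tendsto' hlim fun n => ?_
  have h1 : ‖(∫ y, u y * K.dens 0 (x - y)) - K.mean u‖ₑ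
      ≤ eLpNorm (K.dens 0) 2 * eLpNorm W 2 * ‖x‖ₑ := by
    have := ENNReal.ofReal_le_ofReal (K.norm_conv_dens_sub_mean_le hu hW h x)
    rwa [ofReal_norm, ENNReal.ofReal_mul (by positivity), ENNReal.ofReal_mul (by positivity),
      ofReal_norm, ENNReal.ofReal_toReal hd.2.ne, ENNReal.ofReal_toReal hW.2.ne] at this
  calc _ = ‖((∫ y, u y * K.dens 0 (x - y)) - K.mean u)
        + ((∫ y, u y * K.dens n (x - y)) - ∫ y, u y * K.dens 0 (x - y))‖ₑ := by congr 1; ring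
    _ ≤ _ := (enorm_add_le _ _).trans (add_le_add h1
        (K.enorm_conv_dens_sub_le hu (hW.locallyIntegrable one_le_two) h n x))

end DyadicKernel

/-- A continuous positive bounded weight with finite mass and finite second moment. -/
structure IsWeight (h₀ : Plane → ℝ) : Prop where
  continuous : Continuous h₀
  pos : ∀ x, 0 < h₀ x
  bounded : ∃ M : ℝ, ∀ x, h₀ x ≤ M
  integrable : Integrable h₀
  integrable_sq : Integrable fun x => ‖x‖ ^ 2 * h₀ x

lemma isWeight_of_eq_rpow {κ : ℝ} (hκ : 4 < κ) {h₀ : Plane → ℝ} (hc : Continuous h₀)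
    (hpos : ∀ x, 0 < h₀ x) (heq : ∀ x : Plane, 1 ≤ ‖x‖ → h₀ x = ‖x‖ ^ (-κ)) : IsWeight h₀ := by
  obtain ⟨M, hM⟩ := (isCompact_closedBall (0 : Plane) 1).bddAbove_image hc.continuousOn
  have hM' : ∀ x : Plane, ‖x‖ ≤ 1 → h₀ x ≤ M := fun x hx =>
    hM ⟨x, by simpa using hx, rfl⟩
  have hM0 : 0 < M := (hpos 0).trans_le (hM' 0 (by simp))
  set C : ℝ := (M + 1) * 2 ^ κ with hC
  have hC0 : 0 < C := by positivity
  have hle : ∀ x, h₀ x ≤ C * (1 + ‖x‖) ^ (-κ) := by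
    intro x
    have h2 : (2 : ℝ) ^ κ * (1 + ‖x‖) ^ (-κ) = ((1 + ‖x‖) / 2) ^ (-κ) := by
      rw [Real.div_rpow (by positivity) (by norm_num), Real.rpow_neg (by norm_num : (0:ℝ) ≤ 2)]
      field_simp
    rw [hC, mul_assoc, h2]
    rcases le_total ‖x‖ 1 with hx | hx
    · have : 1 ≤ ((1 + ‖x‖) / 2) ^ (-κ) :=
        Real.one_le_rpow_of_pos_of_le_one_of_nonpos (by positivity) (by linarith) (by linarith)
      nlinarith [hM' x hx]
    · rw [heq x hx]
      have : ‖x‖ ^ (-κ) ≤ ((1 + ‖x‖) / 2) ^ (-κ) :=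
        Real.rpow_le_rpow_of_nonpos (by positivity) (by linarith) (by linarith)
      have h3 : 0 ≤ ((1 + ‖x‖) / 2) ^ (-κ) := by positivity
      nlinarith
  have hle2 : ∀ x, ‖x‖ ^ 2 * h₀ x ≤ C * (1 + ‖x‖) ^ (-(κ - 2)) := by
    intro x
    have h1 : (1 + ‖x‖) ^ (-(κ - 2)) = (1 + ‖x‖) ^ 2 * (1 + ‖x‖) ^ (-κ) := by
      rw [← Real.rpow_natCast, ← Real.rpow_add (by positivity)]
      congr 1; push_cast; ring
    rw [h1]
    calc ‖x‖ ^ 2 * h₀ x ≤ (1 + ‖x‖) ^ 2 * (C * (1 + ‖x‖) ^ (-κ)) := by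
          gcongr
          · exact (hpos x).le
          · linarith
          · exact hle x
      _ = _ := by ring
  have hf : (Module.finrank ℝ Plane : ℝ) = 2 := by simp
  refine ⟨hc, hpos, ⟨C, fun x => (hle x).trans ?_⟩, ?_, ?_⟩
  · refine mul_le_of_le_one_right hC0.le ?_
    exact Real.rpow_le_one_of_one_le_of_nonpos (by linarith [norm_nonneg x]) (by linarith)
  · refine Integrable.mono' ((integrable_one_add_norm (r := κ) (by rw [hf]; linarith)).const_mul C)
      hc.aestronglyMeasurable (Eventually.of_forall fun x => ?_)
    rw [Real.norm_of_nonneg (hpos x).le]; exact hle x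
  · refine Integrable.mono' ((integrable_one_add_norm (r := κ - 2)
      (by rw [hf]; linarith)).const_mul C)
      (by fun_prop) (Eventually.of_forall fun x => ?_)
    rw [Real.norm_of_nonneg (mul_nonneg (by positivity) (hpos x).le)]; exact hle2 x

lemma ennreal_add_sq_le (a b : ℝ≥0∞) : (a + b) ^ 2 ≤ 2 * (a ^ 2 + b ^ 2) := by
  have := ENNReal.rpow_add_le_mul_rpow_add_rpow a b (p := 2) (by norm_num)
  norm_num at this
  simpa using this

namespace IsWeight

variable {h₀ : Plane → ℝ} (hw : IsWeight h₀)
include hw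

lemma measurable_ofReal : Measurable fun x => ENNReal.ofReal (h₀ x) :=
  hw.continuous.measurable.ennreal_ofReal

lemma isFiniteMeasure : IsFiniteMeasure (wMeasure h₀) :=
  isFiniteMeasure_withDensity_ofReal hw.integrable.2

lemma volume_ac : (volume : Measure Plane) ≪ wMeasure h₀ :=
  withDensity_absolutelyContinuous' hw.measurable_ofReal.aemeasurable
    (Eventually.of_forall fun x => by simpa using hw.pos x)

omit hw in
lemma ac_volume : wMeasure h₀ ≪ (volume : Measure Plane) :=
  withDensity_absolutelyContinuous _ _

lemma integrable_iff {g : Plane → ℝ} :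
    Integrable g (wMeasure h₀) ↔ Integrable fun x => h₀ x * g x := by
  rw [wMeasure, integrable_withDensity_iff_integrable_smul' hw.measurable_ofReal
    (Eventually.of_forall fun x => ENNReal.ofReal_lt_top)]
  simp [ENNReal.toReal_ofReal (hw.pos _).le]

lemma integral_eq (g : Plane → ℝ) : ∫ x, g x ∂(wMeasure h₀) = ∫ x, h₀ x * g x := by
  rw [wMeasure, integral_withDensity_eq_integral_toReal_smul hw.measurable_ofReal
    (Eventually.of_forall fun x => ENNReal.ofReal_lt_top)]
  simp [ENNReal.toReal_ofReal (hw.pos _).le]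

lemma locallyIntegrable {u : Plane → ℝ} (hu : MemLp u 2 (wMeasure h₀)) :
    LocallyIntegrable u := by
  have := hw.isFiniteMeasure
  have h1 : LocallyIntegrable fun x => h₀ x * u x :=
    (hw.integrable_iff.1 (hu.integrable one_le_two)).locallyIntegrable
  have h2 := h1.continuous_mul (hw.continuous.inv₀ fun x => (hw.pos x).ne')
  refine h2.congr (Eventually.of_forall fun x => ?_)
  simp [inv_mul_cancel_left₀ (hw.pos x).ne']

lemma memLp_div {φ : Plane → ℝ} (hφ : Continuous φ) (hφs : HasCompactSupport φ) :
    MemLp (fun x => φ x / h₀ x) 2 (wMeasure h₀) := by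
  have := hw.isFiniteMeasure
  refine Continuous.memLp_of_hasCompactSupport (hφ.div hw.continuous fun x => (hw.pos x).ne') ?_
  exact hφs.mono fun x hx => by
    contrapose! hx; simp only [Function.mem_support, not_not] at hx ⊢; simp [hx]

lemma integral_mul_eq (u φ : Plane → ℝ) :
    ∫ x, u x * φ x = ∫ x, (φ x / h₀ x) * u x ∂(wMeasure h₀) := by
  rw [hw.integral_eq]
  congr 1; funext x
  have := (hw.pos x).ne'
  field_simp

lemma lintegral_sq_norm_lt_top : ∫⁻ x, ‖x‖ₑ ^ 2 ∂(wMeasure h₀) < ⊤ := by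
  have : Integrable (fun x : Plane => ‖x‖ ^ 2) (wMeasure h₀) :=
    hw.integrable_iff.2 (by simpa only [mul_comm] using hw.integrable_sq)
  simpa [HasFiniteIntegral, enorm_pow] using this.2

/-- A weighted Poincaré inequality around the `ρ`-mean. -/
theorem exists_eLpNorm_sub_mean_le (K : DyadicKernel) :
    ∃ C : ℝ≥0, ∀ (u : Plane → ℝ) (W : Plane → Plane), LocallyIntegrable u → MemLp W 2 →
      IsWeakGrad u W →
      eLpNorm (fun x => u x - K.mean u) 2 (wMeasure h₀) ≤ C * eLpNorm W 2 := by
  obtain ⟨M, hM⟩ := hw.bounded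
  have hd : MemLp (K.dens 0) 2 :=
    (K.contDiff_dens 0).continuous.memLp_of_hasCompactSupport (K.hasCompactSupport_dens 0)
  set D := eLpNorm (K.dens 0) 2
  set S := ∫⁻ x, ‖x‖ₑ ^ 2 ∂(wMeasure h₀)
  set G := ∫⁻ z, K.gradMass z
  set Q : ℝ≥0∞ := 2 * (D ^ 2 * S + ENNReal.ofReal M * G ^ 2) with hQ
  have hQt : Q ≠ ⊤ := by
    refine ENNReal.mul_ne_top (by simp) (ENNReal.add_ne_top.2 ⟨?_, ?_⟩)
    · exact ENNReal.mul_ne_top (ENNReal.pow_ne_top hd.2.ne) hw.lintegral_sq_norm_lt_top.ne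
    · exact ENNReal.mul_ne_top ENNReal.ofReal_ne_top
        (ENNReal.pow_ne_top K.lintegral_gradMass_lt_top.ne)
  refine ⟨(Q ^ (1 / 2 : ℝ)).toNNReal, fun u W hu hW h => ?_⟩
  rw [ENNReal.coe_toNNReal (ENNReal.rpow_ne_top_of_nonneg (by norm_num) hQt)]
  set w := eLpNorm W 2 with hwW
  have hw2 : ∫⁻ y, ‖W y‖ₑ ^ 2 = w ^ 2 := by
    have := eLpNorm_nnreal_pow_eq_lintegral (f := W) (μ := volume) (p := 2) (by norm_num)
    simpa using this.symm
  have hmeas : Measurable fun x : Plane => D * w * ‖x‖ₑ := by fun_prop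
  have key : ∫⁻ x, ‖u x - K.mean u‖ₑ ^ 2 ∂(wMeasure h₀) ≤ Q * w ^ 2 := by
    calc ∫⁻ x, ‖u x - K.mean u‖ₑ ^ 2 ∂(wMeasure h₀)
        ≤ ∫⁻ x, 2 * ((D * w * ‖x‖ₑ) ^ 2 + (∫⁻ y, K.gradMass (x - y) * ‖W y‖ₑ) ^ 2)
            ∂(wMeasure h₀) := by
          refine lintegral_mono_ae ?_
          filter_upwards [ac_volume (K.ae_enorm_sub_mean_le hu hW h)] with x hx
          refine (pow_le_pow_left' hx 2).trans ?_
          exact ennreal_add_sq_le _ _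
      _ = 2 * (∫⁻ x, (D * w * ‖x‖ₑ) ^ 2 ∂(wMeasure h₀)
            + ∫⁻ x, (∫⁻ y, K.gradMass (x - y) * ‖W y‖ₑ) ^ 2 ∂(wMeasure h₀)) := by
          rw [lintegral_const_mul' _ _ (by simp), lintegral_add_left (hmeas.pow_const 2)]
      _ ≤ 2 * (D ^ 2 * w ^ 2 * S + ENNReal.ofReal M * (G ^ 2 * w ^ 2)) := by
          gcongr
          · simp_rw [mul_pow]
            rw [lintegral_const_mul _ (by fun_prop)]
          · calc _ ≤ ∫⁻ x, ENNReal.ofReal M * (∫⁻ y, K.gradMass (x - y) * ‖W y‖ₑ) ^ 2 := by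
                  rw [wMeasure]
                  refine (lintegral_withDensity_le_lintegral_mul _ hw.measurable_ofReal _).trans ?_
                  refine lintegral_mono fun x => ?_
                  simp only [Pi.mul_apply]
                  gcongr
                  exact hM x
              _ ≤ _ := by
                  rw [lintegral_const_mul' _ _ ENNReal.ofReal_ne_top, ← hw2]
                  gcongr
                  exact lintegral_sq_conv_le K.measurable_gradMass hW.1.enorm
      _ = Q * w ^ 2 := by rw [hQ]; ring
  have h2 := eLpNorm_nnreal_pow_eq_lintegral (f := fun x => u x - K.mean u) (μ := wMeasure h₀)
    (p := 2) (by norm_num)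
  have h3 : eLpNorm (fun x => u x - K.mean u) 2 (wMeasure h₀) ^ 2
      = ∫⁻ x, ‖u x - K.mean u‖ₑ ^ 2 ∂(wMeasure h₀) := by simpa using h2
  rw [← ENNReal.pow_le_pow_left_iff (n := 2) (by norm_num), h3, mul_pow, ← ENNReal.rpow_natCast (Q ^ _),
    ← ENNReal.rpow_mul]
  simpa using key

end IsWeight

lemma inner_gradient_eq (u : Plane → ℝ) (x v : Plane) :
    inner ℝ (gradient u x) v = fderiv ℝ u x v := by
  simp [gradient]

lemma measurable_gradient (u : Plane → ℝ) : Measurable (gradient u) :=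
  (InnerProductSpace.toDual ℝ Plane).symm.continuous.measurable.comp (measurable_fderiv ℝ u)

lemma isWeakGrad_gradient {u : Plane → ℝ} (hu : Differentiable ℝ u)
    (hg : LocallyIntegrable (gradient u)) : IsWeakGrad u (gradient u) := by
  intro φ hφ hφs v
  have hu' : LocallyIntegrable u := hu.continuous.locallyIntegrable
  simp_rw [inner_gradient_eq, mul_comm (φ _)]
  refine integral_mul_fderiv_eq_neg_fderiv_mul_of_integrable ?_ ?_ ?_ (fun x _ => hu x)
    (fun x _ => hφ.differentiable (by simp) x)
  · simpa only [inner_gradient_eq, mul_comm] using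
      integrable_inner_of_hasCompactSupport hg hφ.continuous hφs v
  · exact integrable_mul_of_hasCompactSupport hu'
      ((hφ.continuous_fderiv (by simp)).clm_apply continuous_const)
      (hφs.fderiv_apply (𝕜 := ℝ) v)
  · exact integrable_mul_of_hasCompactSupport hu' hφ.continuous hφs

lemma IsWeakGrad.ae_unique {u : Plane → ℝ} {W W' : Plane → Plane} (hW : LocallyIntegrable W)
    (hW' : LocallyIntegrable W') (h : IsWeakGrad u W) (h' : IsWeakGrad u W') : W =ᵐ[volume] W' := by
  have key : ∀ i, ∀ᵐ x, inner ℝ (W x) (unitVec i) = inner ℝ (W' x) (unitVec i) := fun i => by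
    refine ae_eq_of_integral_contDiff_smul_eq ?_ ?_ fun φ hφ hφs => ?_
    · exact fun x => let ⟨s, hs, hi⟩ := hW x; ⟨s, hs, Integrable.inner_const hi _⟩
    · exact fun x => let ⟨s, hs, hi⟩ := hW' x; ⟨s, hs, Integrable.inner_const hi _⟩
    · simpa using (h φ hφ hφs (unitVec i)).symm.trans (h' φ hφ hφs (unitVec i))
  filter_upwards [ae_all_iff.2 key] with x hx
  ext i
  simpa [unitVec, EuclideanSpace.inner_single_right] using hx i

lemma IsWeakGrad.congr {u u' : Plane → ℝ} {W W' : Plane → Plane} (h : IsWeakGrad u W)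
    (hu : u =ᵐ[volume] u') (hW : W =ᵐ[volume] W') : IsWeakGrad u' W' := by
  intro φ hφ hφs v
  have h1 : ∫ x, u' x * fderiv ℝ φ x v = ∫ x, u x * fderiv ℝ φ x v :=
    integral_congr_ae (by filter_upwards [hu] with x hx; rw [hx])
  have h2 : ∫ x, φ x * inner ℝ (W' x) v = ∫ x, φ x * inner ℝ (W x) v :=
    integral_congr_ae (by filter_upwards [hW] with x hx; rw [hx])
  rw [h1, h2, h φ hφ hφs v]

lemma IsWeakGrad.add_const {u : Plane → ℝ} {W : Plane → Plane} (hu : LocallyIntegrable u)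
    (h : IsWeakGrad u W) (c : ℝ) : IsWeakGrad (fun x => u x + c) W := by
  intro φ hφ hφs v
  have hd : Continuous fun x => fderiv ℝ φ x v :=
    (hφ.continuous_fderiv (by simp)).clm_apply continuous_const
  have hds : HasCompactSupport fun x => fderiv ℝ φ x v := hφs.fderiv_apply (𝕜 := ℝ) v
  have h0 : ∫ x, fderiv ℝ φ x v = 0 := by
    have := integral_mul_fderiv_eq_neg_fderiv_mul_of_integrable (μ := (volume : Measure Plane))
      (f := fun _ => (1 : ℝ)) (g := φ)
      (v := v) (by simp) (by simpa using hd.integrable_of_hasCompactSupport hds)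
      (by simpa using hφ.continuous.integrable_of_hasCompactSupport hφs)
      (fun x _ => differentiableAt_const _) (fun x _ => hφ.differentiable (by simp) x)
    simpa using this
  simp_rw [add_mul]
  rw [integral_add (integrable_mul_of_hasCompactSupport hu hd hds)
    ((hd.integrable_of_hasCompactSupport hds).const_mul c), integral_const_mul, h0, mul_zero,
    add_zero, h φ hφ hφs v]

lemma isWeakGrad_zero : IsWeakGrad (fun _ => 0) (fun _ => 0) := by
  intro φ _ _ v; simp

lemma IsWeakGrad.linear_comb {u u' : Plane → ℝ} {W W' : Plane → Plane}
    (hu : LocallyIntegrable u) (hu' : LocallyIntegrable u') (hW : LocallyIntegrable W)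
    (hW' : LocallyIntegrable W') (h : IsWeakGrad u W) (h' : IsWeakGrad u' W') (a b : ℝ) :
    IsWeakGrad (fun x => a * u x + b * u' x) (fun x => a • W x + b • W' x) := by
  intro φ hφ hφs v
  have hd : Continuous fun x => fderiv ℝ φ x v :=
    (hφ.continuous_fderiv (by simp)).clm_apply continuous_const
  have hds : HasCompactSupport fun x => fderiv ℝ φ x v := hφs.fderiv_apply (𝕜 := ℝ) v
  have e1 : ∀ x, (a * u x + b * u' x) * fderiv ℝ φ x v
      = a * (u x * fderiv ℝ φ x v) + b * (u' x * fderiv ℝ φ x v) := fun x => by ring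
  have e2 : ∀ x, φ x * inner ℝ (a • W x + b • W' x) v
      = a * (φ x * inner ℝ (W x) v) + b * (φ x * inner ℝ (W' x) v) := fun x => by
    rw [inner_add_left, real_inner_smul_left, real_inner_smul_left]; ring
  simp_rw [e1, e2]
  rw [integral_add ((integrable_mul_of_hasCompactSupport hu hd hds).const_mul a)
    ((integrable_mul_of_hasCompactSupport hu' hd hds).const_mul b),
    integral_add ((integrable_inner_of_hasCompactSupport hW hφ.continuous hφs v).const_mul a)
    ((integrable_inner_of_hasCompactSupport hW' hφ.continuous hφs v).const_mul b)]
  simp only [integral_const_mul]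
  rw [h φ hφ hφs v, h' φ hφ hφs v]
  ring

lemma memLp_two_of_integrable_norm_sq {E : Type*} [NormedAddCommGroup E] {ν : Measure Plane}
    {g : Plane → E} (hg : AEStronglyMeasurable g ν) (h : Integrable (fun x => ‖g x‖ ^ 2) ν) :
    MemLp g 2 ν := (memLp_two_iff_integrable_sq_norm hg).2 h

namespace MemH

variable {h₀ u : Plane → ℝ} (hu : MemH h₀ u)
include hu

lemma memLp_gradient : MemLp (gradient u) 2 :=
  memLp_two_of_integrable_norm_sq (measurable_gradient u).aestronglyMeasurable hu.2.1

lemma memLp : MemLp u 2 (wMeasure h₀) :=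
  memLp_two_of_integrable_norm_sq hu.1.continuous.aestronglyMeasurable (by simpa using hu.2.2)

lemma isWeakGrad : IsWeakGrad u (gradient u) :=
  isWeakGrad_gradient hu.1 (hu.memLp_gradient.locallyIntegrable one_le_two)

end MemH

lemma memH_of_ae_eq {h₀ : Plane → ℝ} {u v : Plane → ℝ} {W : Plane → Plane} (hu : ContDiff ℝ 1 u)
    (hv : MemLp v 2 (wMeasure h₀)) (hW : MemLp W 2) (h : IsWeakGrad v W) (huv : u =ᵐ[volume] v) :
    MemH h₀ u ∧ gradient u =ᵐ[volume] W := by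
  have hc : Continuous (gradient u) :=
    (InnerProductSpace.toDual ℝ Plane).symm.continuous.comp (hu.continuous_fderiv one_ne_zero)
  have hd := hu.differentiable one_ne_zero
  have hg : gradient u =ᵐ[volume] W :=
    IsWeakGrad.ae_unique hc.locallyIntegrable (hW.locallyIntegrable one_le_two)
      (isWeakGrad_gradient hd hc.locallyIntegrable) (h.congr huv.symm (ae_eq_refl _))
  refine ⟨⟨hd, ?_, ?_⟩, hg⟩
  · exact ((memLp_two_iff_integrable_sq_norm hW.1).1 hW).congr
      (by filter_upwards [hg] with x hx; rw [hx])
  · have h2 := (memLp_two_iff_integrable_sq_norm hv.1).1 hv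
    refine h2.congr ?_
    filter_upwards [IsWeight.ac_volume huv] with x hx
    simp [hx]

/-- A decreasing sequence of nonempty closed convex sets in a Hilbert space, contained in a ball,
has a common point. -/
theorem exists_mem_iInter_of_convex {F : Type*} [NormedAddCommGroup F] [InnerProductSpace ℝ F]
    [CompleteSpace F] (C : ℕ → Set F) (hanti : Antitone C) (hne : ∀ n, (C n).Nonempty)
    (hcl : ∀ n, IsClosed (C n)) (hcv : ∀ n, Convex ℝ (C n)) {R : ℝ}
    (hR : ∀ x ∈ C 0, ‖x‖ ≤ R) : ∃ x, ∀ n, x ∈ C n := by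
  have hmin : ∀ n, ∃ v ∈ C n, ∀ w ∈ C n, ‖v‖ ≤ ‖w‖ := fun n => by
    obtain ⟨v, hv, h⟩ := exists_norm_eq_iInf_of_complete_convex (hne n) (hcl n).isComplete (hcv n) 0
    refine ⟨v, hv, fun w hw => ?_⟩
    simp only [zero_sub, norm_neg] at h
    rw [h]
    exact ciInf_le ⟨0, Set.forall_mem_range.2 fun _ => norm_nonneg _⟩ (⟨w, hw⟩ : C n)
  choose v hv hvmin using hmin
  have hmono : Monotone fun n => ‖v n‖ ^ 2 := fun n m hnm => by
    have := hvmin n (v m) (hanti hnm (hv m))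
    simp only; gcongr
  have hbdd : BddAbove (Set.range fun n => ‖v n‖ ^ 2) := by
    refine ⟨R ^ 2, Set.forall_mem_range.2 fun n => ?_⟩
    have := hR _ (hanti (Nat.zero_le n) (hv n))
    gcongr
  have hlim := tendsto_atTop_ciSup hmono hbdd
  have hdist : ∀ n m, n ≤ m → ‖v n - v m‖ ^ 2 ≤ 2 * (‖v m‖ ^ 2 - ‖v n‖ ^ 2) := fun n m hnm => by
    have hmid : (1 / 2 : ℝ) • v n + (1 / 2 : ℝ) • v m ∈ C n :=
      hcv n (hv n) (hanti hnm (hv m)) (by norm_num) (by norm_num) (by norm_num)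
    have h1 := hvmin n _ hmid
    rw [← smul_add, norm_smul] at h1
    have h2 := parallelogram_law_with_norm ℝ (v n) (v m)
    norm_num at h1
    nlinarith [norm_nonneg (v n), norm_nonneg (v n + v m)]
  have hcauchy : CauchySeq v := by
    rw [Metric.cauchySeq_iff']
    intro ε hε
    obtain ⟨N, hN⟩ := (Metric.cauchySeq_iff'.1 hlim.cauchySeq) (ε ^ 2 / 2) (by positivity)
    refine ⟨N, fun n hn => ?_⟩
    have h1 := hdist N n hn
    have h2 := hN n hn
    rw [Real.dist_eq] at h2
    have h3 := le_abs_self (‖v n‖ ^ 2 - ‖v N‖ ^ 2)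
    rw [dist_comm, dist_eq_norm]
    exact lt_of_pow_lt_pow_left₀ 2 hε.le (by linarith)
  obtain ⟨x, hx⟩ := cauchySeq_tendsto_of_complete hcauchy
  refine ⟨x, fun n => (hcl n).mem_of_tendsto hx ?_⟩
  filter_upwards [eventually_ge_atTop n] with m hm using hanti hm (hv m)

/-- A coercive continuous convex function attains its minimum on a closed convex set. -/
theorem exists_isMinOn_of_convexOn {F : Type*} [NormedAddCommGroup F] [InnerProductSpace ℝ F]
    [CompleteSpace F] {S : Set F} {I : F → ℝ} (hne : S.Nonempty) (hcl : IsClosed S)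
    (hI : ConvexOn ℝ S I) (hc : Continuous I) (hbdd : BddBelow (I '' S))
    (hcoer : ∀ c, ∃ R, ∀ x ∈ S, I x ≤ c → ‖x‖ ≤ R) : ∃ x ∈ S, ∀ y ∈ S, I x ≤ I y := by
  set m := sInf (I '' S) with hm
  have hlt : ∀ n : ℕ, m < m + 1 / (n + 1 : ℝ) := fun n => by
    have : (0 : ℝ) < 1 / (n + 1 : ℝ) := by positivity
    linarith
  obtain ⟨R, hR⟩ := hcoer (m + 1 / ((0 : ℕ) + 1 : ℝ))
  obtain ⟨x, hx⟩ := exists_mem_iInter_of_convex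
    (fun n : ℕ => {x ∈ S | I x ≤ m + 1 / (n + 1 : ℝ)})
    (fun i j hij x hx => ⟨hx.1, hx.2.trans (by gcongr)⟩)
    (fun n => by
      obtain ⟨_, ⟨x, hx, rfl⟩, hlt'⟩ := exists_lt_of_csInf_lt (hne.image I) (hlt n)
      exact ⟨x, hx, hlt'.le⟩)
    (fun n => hcl.inter (isClosed_le hc continuous_const))
    (fun n => hI.convex_le _) (fun x hx => hR x hx.1 hx.2)
  refine ⟨x, (hx 0).1, fun y hy => ?_⟩
  have h1 : I x ≤ m := by
    have h2 : Tendsto (fun n : ℕ => m + 1 / (n + 1 : ℝ)) atTop (𝓝 (m + 0)) :=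
      (tendsto_one_div_add_atTop_nhds_zero_nat (𝕜 := ℝ)).const_add m
    rw [add_zero] at h2
    exact ge_of_tendsto' h2 fun n => (hx n).2
  exact h1.trans (csInf_le hbdd ⟨y, hy, rfl⟩)

/-- `u` belongs to the weighted Sobolev space, with distributional gradient `W`. -/
structure WeakH (h₀ : Plane → ℝ) (u : Plane → ℝ) (W : Plane → Plane) : Prop where
  memLp : MemLp u 2 (wMeasure h₀)
  memLp_grad : MemLp W 2
  isWeakGrad : IsWeakGrad u W

lemma MemH.weakH {h₀ u : Plane → ℝ} (hu : MemH h₀ u) : WeakH h₀ u (gradient u) :=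
  ⟨hu.memLp, hu.memLp_gradient, hu.isWeakGrad⟩

lemma IsWeight.continuous_integral_mul {h₀ : Plane → ℝ} (hw : IsWeight h₀) {φ : Plane → ℝ}
    (hφ : Continuous φ) (hφs : HasCompactSupport φ) :
    Continuous fun u : Lp ℝ 2 (wMeasure h₀) => ∫ x, u x * φ x := by
  have h : ∀ u : Lp ℝ 2 (wMeasure h₀), ∫ x, u x * φ x
      = inner ℝ (hw.memLp_div hφ hφs).toLp u := fun u => by
    rw [hw.integral_mul_eq, L2.inner_def]
    refine integral_congr_ae ?_
    filter_upwards [(hw.memLp_div hφ hφs).coeFn_toLp] with x hx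
    rw [hx]; simp [mul_comm]
  simp_rw [h]
  exact continuous_const.inner continuous_id

lemma continuous_integral_inner {φ : Plane → ℝ} (hφ : Continuous φ) (hφs : HasCompactSupport φ)
    (v : Plane) : Continuous fun W : Lp Plane 2 (volume : Measure Plane) =>
      ∫ x, φ x * inner ℝ (W x) v := by
  have hm : MemLp (fun x => φ x • v) 2 (volume : Measure Plane) :=
    (hφ.smul continuous_const).memLp_of_hasCompactSupport hφs.smul_right
  have h : ∀ W : Lp Plane 2 (volume : Measure Plane), ∫ x, φ x * inner ℝ (W x) v
      = inner ℝ hm.toLp W := fun W => by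
    rw [L2.inner_def]
    refine integral_congr_ae ?_
    filter_upwards [hm.coeFn_toLp] with x hx
    rw [hx, real_inner_smul_left, real_inner_comm]
  simp_rw [h]
  exact continuous_const.inner continuous_id

lemma IsWeight.isClosed_isWeakGrad {h₀ : Plane → ℝ} (hw : IsWeight h₀) :
    IsClosed {z : Lp ℝ 2 (wMeasure h₀) × Lp Plane 2 (volume : Measure Plane) |
      IsWeakGrad z.1 z.2} := by
  have : {z : Lp ℝ 2 (wMeasure h₀) × Lp Plane 2 (volume : Measure Plane) | IsWeakGrad z.1 z.2}
      = ⋂ (φ : Plane → ℝ) (_ : ContDiff ℝ ∞ φ) (_ : HasCompactSupport φ) (v : Plane),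
        {z | ∫ x, z.1 x * fderiv ℝ φ x v = -∫ x, φ x * inner ℝ (z.2 x) v} := by
    ext z; simp [IsWeakGrad]
  rw [this]
  refine isClosed_iInter fun φ => isClosed_iInter fun hφ => isClosed_iInter fun hφs =>
    isClosed_iInter fun v => isClosed_eq ?_ ?_
  · exact (hw.continuous_integral_mul ((hφ.continuous_fderiv (by simp)).clm_apply continuous_const)
      (hφs.fderiv_apply (𝕜 := ℝ) v)).comp continuous_fst
  · exact ((continuous_integral_inner hφ.continuous hφs v).comp continuous_snd).neg

/-- The total mass of `V e^w`. -/
def expMass (V w : Plane → ℝ) : ℝ≥0∞ := ∫⁻ x, ENNReal.ofReal (V x * Real.exp (w x))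

lemma expMass_congr {V w w' : Plane → ℝ} (h : w =ᵐ[volume] w') : expMass V w = expMass V w' :=
  lintegral_congr_ae (by filter_upwards [h] with x hx; rw [hx])

lemma integrable_of_expMass_lt_top {V w : Plane → ℝ} (hV : Continuous V) (hVn : ∀ x, 0 ≤ V x)
    (hw : AEStronglyMeasurable w volume) (h : expMass V w ≠ ⊤) :
    Integrable fun x => V x * Real.exp (w x) := by
  have hm : AEStronglyMeasurable (fun x => V x * Real.exp (w x)) volume :=
    hV.aestronglyMeasurable.mul (Real.continuous_exp.comp_aestronglyMeasurable hw)
  exact (lintegral_ofReal_ne_top_iff_integrable hm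
    (Eventually.of_forall fun x => mul_nonneg (hVn x) (Real.exp_pos _).le)).1 h

lemma expMass_le_iff {V w : Plane → ℝ} (hVn : ∀ x, 0 ≤ V x)
    (h : Integrable fun x => V x * Real.exp (w x)) {A : ℝ} (hA : 0 ≤ A) :
    expMass V w ≤ ENNReal.ofReal A ↔ ∫ x, V x * Real.exp (w x) ≤ A := by
  rw [expMass, ← ofReal_integral_eq_lintegral_ofReal h
    (Eventually.of_forall fun x => mul_nonneg (hVn x) (Real.exp_pos _).le),
    ENNReal.ofReal_le_ofReal_iff hA]

lemma expMass_le_of_integral_le {V w : Plane → ℝ} (hVn : ∀ x, 0 ≤ V x)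
    (h : Integrable fun x => V x * Real.exp (w x)) {A : ℝ}
    (hle : ∫ x, V x * Real.exp (w x) ≤ A) : expMass V w ≤ ENNReal.ofReal A :=
  (expMass_le_iff hVn h ((integral_nonneg fun x =>
    mul_nonneg (hVn x) (Real.exp_pos _).le).trans hle)).2 hle

lemma IsWeight.isClosed_expMass_le {h₀ : Plane → ℝ} (hw : IsWeight h₀) {V : Plane → ℝ}
    (hV : Continuous V) (A : ℝ≥0∞) :
    IsClosed {w : Lp ℝ 2 (wMeasure h₀) | expMass V w ≤ A} := by
  refine IsSeqClosed.isClosed fun w w₀ hwn hlim => ?_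
  obtain ⟨ns, -, hns⟩ := (tendstoInMeasure_of_tendsto_Lp hlim).exists_seq_tendsto_ae
  have hns' := hw.volume_ac hns
  have hlim' : ∀ᵐ x, Tendsto (fun i => ENNReal.ofReal (V x * Real.exp (w (ns i) x))) atTop
      (𝓝 (ENNReal.ofReal (V x * Real.exp (w₀ x)))) := by
    filter_upwards [hns'] with x hx
    exact ENNReal.tendsto_ofReal (((Real.continuous_exp.tendsto _).comp hx).const_mul _)
  calc expMass V w₀ = ∫⁻ x, liminf (fun i => ENNReal.ofReal (V x * Real.exp (w (ns i) x))) atTop :=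
        lintegral_congr_ae (by filter_upwards [hlim'] with x hx; exact hx.liminf_eq.symm)
    _ ≤ liminf (fun i => expMass V (w (ns i))) atTop := by
        refine lintegral_liminf_le' fun i => ?_
        have : AEStronglyMeasurable (w (ns i)) volume :=
          (Lp.aestronglyMeasurable (w (ns i))).mono_ac hw.volume_ac
        exact ((hV.aestronglyMeasurable.mul
          (Real.continuous_exp.comp_aestronglyMeasurable this)).aemeasurable).ennreal_ofReal
    _ ≤ A := by
        refine (liminf_le_liminf (v := fun _ => A) (Eventually.of_forall fun i => hwn _)).trans ?_
        simp

lemma IsWeight.convex_expMass_le {h₀ : Plane → ℝ} (hw : IsWeight h₀) {V : Plane → ℝ}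
    (hV : Continuous V) (hVn : ∀ x, 0 ≤ V x) (A : ℝ≥0∞) :
    Convex ℝ {w : Lp ℝ 2 (wMeasure h₀) | expMass V w ≤ A} := by
  intro w hwA w' hwA' s t hs ht hst
  have hc : ⇑(s • w + t • w') =ᵐ[volume] fun x => s * w x + t * w' x := by
    filter_upwards [hw.volume_ac (Lp.coeFn_add (s • w) (t • w')),
      hw.volume_ac (Lp.coeFn_smul s w), hw.volume_ac (Lp.coeFn_smul t w')] with x h1 h2 h3
    rw [h1, Pi.add_apply, h2, h3]; rfl
  have hm : ∀ w : Lp ℝ 2 (wMeasure h₀),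
      AEMeasurable (fun x => ENNReal.ofReal (V x * Real.exp (w x))) := fun w =>
    ((hV.aestronglyMeasurable.mul (Real.continuous_exp.comp_aestronglyMeasurable
      ((Lp.aestronglyMeasurable w).mono_ac hw.volume_ac))).aemeasurable).ennreal_ofReal
  simp only [Set.mem_ofPred_eq] at hwA hwA' ⊢
  rw [expMass_congr hc]
  calc expMass V (fun x => s * w x + t * w' x)
      ≤ ∫⁻ x, (ENNReal.ofReal s * ENNReal.ofReal (V x * Real.exp (w x))
          + ENNReal.ofReal t * ENNReal.ofReal (V x * Real.exp (w' x))) := by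
        refine lintegral_mono fun x => ?_
        rw [← ENNReal.ofReal_mul hs, ← ENNReal.ofReal_mul ht, ← ENNReal.ofReal_add
          (mul_nonneg hs (mul_nonneg (hVn x) (Real.exp_pos _).le))
          (mul_nonneg ht (mul_nonneg (hVn x) (Real.exp_pos _).le))]
        refine ENNReal.ofReal_le_ofReal ?_
        have := convexOn_exp.2 (Set.mem_univ (w x)) (Set.mem_univ (w' x)) hs ht hst
        simp only [smul_eq_mul] at this
        nlinarith [mul_le_mul_of_nonneg_left this (hVn x)]
    _ = ENNReal.ofReal s * expMass V w + ENNReal.ofReal t * expMass V w' := by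
        rw [lintegral_add_left' ((hm w).const_mul _), lintegral_const_mul'' _ (hm w),
          lintegral_const_mul'' _ (hm w')]
        rfl
    _ ≤ ENNReal.ofReal s * A + ENNReal.ofReal t * A := by gcongr
    _ = A := by rw [← add_mul, ← ENNReal.ofReal_add hs ht, hst, ENNReal.ofReal_one, one_mul]

/-- A Jensen-type bound of the `μ`-mean of `w` by the mass of `V e^w`. -/
lemma IsWeight.exists_integral_le {h₀ : Plane → ℝ} (hw : IsWeight h₀) {V : Plane → ℝ}
    (hVn : ∀ x, 0 ≤ V x) {SV : Set Plane} (hSV : SV.Finite)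
    (hVpos : ∀ x ∉ SV, 0 < V x) (hlogV : Integrable (fun x => Real.log (V x)) (wMeasure h₀))
    (A : ℝ) : ∃ C : ℝ, ∀ w : Plane → ℝ, Integrable w (wMeasure h₀) →
      (Integrable fun x => V x * Real.exp (w x)) → ∫ x, V x * Real.exp (w x) ≤ A →
      ∫ x, w x ∂(wMeasure h₀) ≤ C := by
  obtain ⟨M, hM⟩ := hw.bounded
  have := hw.isFiniteMeasure
  refine ⟨M * A - ∫ x, Real.log (V x) + 1 ∂(wMeasure h₀), fun w hwi hVw hA => ?_⟩
  have hM0 : 0 < M := (hw.pos 0).trans_le (hM 0)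
  have hli : Integrable (fun x => Real.log (V x) + 1) (wMeasure h₀) :=
    hlogV.add (integrable_const _)
  have hsum := hw.integrable_iff.1 (hwi.add hli)
  rw [le_sub_iff_add_le, ← integral_add hwi hli, hw.integral_eq]
  calc _ ≤ ∫ x, M * (V x * Real.exp (w x)) := by
        refine integral_mono_ae hsum (hVw.const_mul M) ?_
        filter_upwards [hSV.countable.ae_notMem volume] with x hx
        have h1 := Real.add_one_le_exp (Real.log (V x) + w x)
        rw [Real.exp_add, Real.exp_log (hVpos x hx)] at h1
        calc h₀ x * (w x + (Real.log (V x) + 1)) ≤ h₀ x * (V x * Real.exp (w x)) :=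
              mul_le_mul_of_nonneg_left (by linarith) (hw.pos x).le
          _ ≤ M * (V x * Real.exp (w x)) :=
              mul_le_mul_of_nonneg_right (hM x) (mul_nonneg (hVn x) (Real.exp_pos _).le)
    _ = M * ∫ x, V x * Real.exp (w x) := integral_const_mul _ _
    _ ≤ M * A := by gcongr

lemma abs_integral_mul_le {ν : Measure Plane} {g k : Plane → ℝ} (hg : MemLp g 2 ν)
    (hk : MemLp k 2 ν) :
    |∫ x, g x * k x ∂ν| ≤ (eLpNorm g 2 ν).toReal * (eLpNorm k 2 ν).toReal := by
  have h : ∫ x, g x * k x ∂ν = inner ℝ hg.toLp hk.toLp := by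
    rw [L2.inner_def]
    refine integral_congr_ae ?_
    filter_upwards [hg.coeFn_toLp, hk.coeFn_toLp] with x h1 h2
    rw [h1, h2]; simp [mul_comm]
  rw [h, ← Lp.norm_toLp g hg, ← Lp.norm_toLp k hk]
  exact abs_real_inner_le_norm _ _

/-- The `L²` norm as a real number. -/
def l2norm {E : Type*} [NormedAddCommGroup E] (ν : Measure Plane) (u : Plane → E) : ℝ :=
  (eLpNorm u 2 ν).toReal

lemma l2norm_nonneg {E : Type*} [NormedAddCommGroup E] (ν : Measure Plane) (u : Plane → E) :
    0 ≤ l2norm ν u := ENNReal.toReal_nonneg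

lemma integral_norm_sq_eq {E : Type*} [NormedAddCommGroup E] {ν : Measure Plane} {u : Plane → E}
    (hu : MemLp u 2 ν) : ∫ x, ‖u x‖ ^ 2 ∂ν = l2norm ν u ^ 2 := by
  have h := hu.eLpNorm_eq_integral_rpow_norm (by norm_num) (by norm_num)
  have h0 : 0 ≤ ∫ x, ‖u x‖ ^ 2 ∂ν := integral_nonneg fun x => by positivity
  rw [l2norm, h, ENNReal.toReal_ofReal (by positivity)]
  simp only [ENNReal.toReal_ofNat, Real.rpow_two]
  rw [← Real.rpow_natCast, ← Real.rpow_mul h0]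
  norm_num

namespace IsWeight

variable {h₀ : Plane → ℝ} (hw : IsWeight h₀) (K : DyadicKernel)
include hw

lemma exists_l2norm_sub_mean_le :
    ∃ C : ℝ, 0 ≤ C ∧ ∀ (u : Plane → ℝ) (W : Plane → Plane), WeakH h₀ u W →
      l2norm (wMeasure h₀) (fun x => u x - K.mean u) ≤ C * l2norm volume W := by
  obtain ⟨C, hC⟩ := hw.exists_eLpNorm_sub_mean_le K
  refine ⟨C, C.2, fun u W h => ?_⟩
  have := hC u W (hw.locallyIntegrable h.memLp) h.memLp_grad h.isWeakGrad
  have h2 := ENNReal.toReal_mono (ENNReal.mul_ne_top ENNReal.coe_ne_top h.memLp_grad.2.ne) this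
  simpa [l2norm] using h2

lemma memLp_sub_const {u : Plane → ℝ} (hu : MemLp u 2 (wMeasure h₀)) (m : ℝ) :
    MemLp (fun x => u x - m) 2 (wMeasure h₀) := by
  have := hw.isFiniteMeasure
  exact hu.sub (memLp_const m)

lemma exists_abs_integral_mul_sub_le {φ : Plane → ℝ} (hφ : Continuous φ)
    (hφs : HasCompactSupport φ) :
    ∃ C : ℝ, 0 ≤ C ∧ ∀ (u : Plane → ℝ) (W : Plane → Plane), WeakH h₀ u W →
      |(∫ x, u x * φ x) - K.mean u * ∫ x, φ x| ≤ C * l2norm volume W := by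
  obtain ⟨C, hC0, hC⟩ := hw.exists_l2norm_sub_mean_le K
  refine ⟨l2norm (wMeasure h₀) (fun x => φ x / h₀ x) * C, mul_nonneg (l2norm_nonneg _ _) hC0,
    fun u W h => ?_⟩
  have h1 : (∫ x, u x * φ x) - K.mean u * ∫ x, φ x
      = ∫ x, (φ x / h₀ x) * (u x - K.mean u) ∂(wMeasure h₀) := by
    rw [← hw.integral_mul_eq (fun x => u x - K.mean u) φ, ← integral_const_mul, ← integral_sub]
    · simp_rw [sub_mul]
    · exact integrable_mul_of_hasCompactSupport (hw.locallyIntegrable h.memLp) hφ hφs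
    · exact (hφ.integrable_of_hasCompactSupport hφs).const_mul _
  rw [h1, mul_assoc]
  refine (abs_integral_mul_le (hw.memLp_div hφ hφs) (hw.memLp_sub_const h.memLp _)).trans ?_
  exact mul_le_mul_of_nonneg_left (hC u W h) (l2norm_nonneg _ _)

lemma exists_abs_integral_sub_le :
    ∃ C : ℝ, 0 ≤ C ∧ ∀ (u : Plane → ℝ) (W : Plane → Plane), WeakH h₀ u W →
      |∫ x, u x ∂(wMeasure h₀) - K.mean u * (wMeasure h₀).real Set.univ|
        ≤ C * l2norm volume W := by
  have := hw.isFiniteMeasure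
  obtain ⟨C, hC0, hC⟩ := hw.exists_l2norm_sub_mean_le K
  refine ⟨l2norm (wMeasure h₀) (fun _ => (1 : ℝ)) * C, mul_nonneg (l2norm_nonneg _ _) hC0,
    fun u W h => ?_⟩
  have h1 : ∫ x, u x ∂(wMeasure h₀) - K.mean u * (wMeasure h₀).real Set.univ
      = ∫ x, 1 * (u x - K.mean u) ∂(wMeasure h₀) := by
    simp_rw [one_mul]
    rw [integral_sub (h.memLp.integrable one_le_two) (integrable_const _), integral_const,
      smul_eq_mul, mul_comm]
  rw [h1, mul_assoc]
  refine (abs_integral_mul_le (memLp_const 1) (hw.memLp_sub_const h.memLp _)).trans ?_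
  exact mul_le_mul_of_nonneg_left (hC u W h) (l2norm_nonneg _ _)

lemma exists_l2norm_le :
    ∃ C : ℝ, 0 ≤ C ∧ ∀ (u : Plane → ℝ) (W : Plane → Plane), WeakH h₀ u W →
      l2norm (wMeasure h₀) u ≤ C * (l2norm volume W + |K.mean u|) := by
  have := hw.isFiniteMeasure
  obtain ⟨C, hC0, hC⟩ := hw.exists_l2norm_sub_mean_le K
  set D := l2norm (wMeasure h₀) (fun _ => (1 : ℝ)) with hD
  have hD0 : 0 ≤ D := l2norm_nonneg _ _
  refine ⟨C + D, by positivity, fun u W h => ?_⟩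
  have h1 : l2norm (wMeasure h₀) u ≤ l2norm (wMeasure h₀) (fun x => u x - K.mean u)
      + |K.mean u| * D := by
    have h2 : u = (fun x => u x - K.mean u) + K.mean u • (fun _ : Plane => (1 : ℝ)) := by
      funext x; simp
    have hm1 := hw.memLp_sub_const h.memLp (K.mean u)
    have hm2 : MemLp (K.mean u • (fun _ : Plane => (1 : ℝ))) 2 (wMeasure h₀) :=
      (memLp_const 1).const_smul _
    have h3 := ENNReal.toReal_mono (ENNReal.add_ne_top.2 ⟨hm1.2.ne, hm2.2.ne⟩)
      (eLpNorm_add_le hm1.1 hm2.1 one_le_two)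
    rw [← h2, ENNReal.toReal_add hm1.2.ne hm2.2.ne, eLpNorm_const_smul, ENNReal.toReal_mul] at h3
    simpa only [hD, l2norm, enorm_eq_nnnorm, ENNReal.coe_toReal, coe_nnnorm, Real.norm_eq_abs] using h3
  have h4 := hC u W h
  have h5 := l2norm_nonneg volume W
  nlinarith [abs_nonneg (K.mean u)]

end IsWeight

lemma real_coercivity {F G σ H c C : ℝ} (hF : F < 0) (hG : 0 < G) (hFG : F + σ * H = G)
    (hc : 0 < c) (hC : 0 ≤ C) : ∃ B : ℝ, ∀ e : ℝ, ∃ R : ℝ, ∀ w₁ w₂ x z p r E : ℝ, 0 ≤ w₁ → 0 ≤ w₂ →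
      x - z ≤ C * (1 + w₁ + w₂) → -z ≤ C * (1 + w₁ + w₂) → |p - x * F| ≤ C * w₁ →
      |r - z * H| ≤ C * w₂ → E = 1 / 2 * w₁ ^ 2 + c * w₂ ^ 2 + p + σ * r →
      B ≤ E ∧ (E ≤ e → w₁ ≤ R ∧ w₂ ≤ R ∧ |x| ≤ R ∧ |z| ≤ R) := by
  set D := C * (1 + |σ| - F + G) with hD
  have hD0 : 0 ≤ D := mul_nonneg hC (by linarith [abs_nonneg σ])
  set d := min (1 / 2) c with hd
  have hd0 : 0 < d := lt_min (by norm_num) hc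
  have hd1 : d ≤ 1 / 2 := min_le_left _ _
  have hd2 : d ≤ c := min_le_right _ _
  refine ⟨-(D + D ^ 2 / d), fun e => ?_⟩
  set T := |e| + D + D ^ 2 / d with hT
  have hT0 : 0 ≤ T := by positivity
  set R := 1 + 2 * T / d with hR
  have hR0 : 0 ≤ R := by positivity
  set s := 1 + R + R with hs
  set T2 := |e| + C * (1 + |σ|) * R with hT2
  set R3 := (T2 + -F * (C * s)) / G with hR3
  set R4 := (T2 + G * (C * s)) / -F with hR4
  have hT20 : 0 ≤ T2 := by positivity
  have hs0 : 0 ≤ s := by positivity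
  have hF' : 0 < -F := by linarith
  have hR30 : 0 ≤ R3 := by positivity
  have hR40 : 0 ≤ R4 := by positivity
  have hCs : 0 ≤ C * s := by positivity
  refine ⟨R + R3 + R4 + 2 * (C * s), fun w₁ w₂ x z p r E h1 h2 h3 h4 h5 h6 hE => ?_⟩
  have hp := abs_le.1 h5
  have hσ : |σ * (r - z * H)| ≤ |σ| * (C * w₂) := by
    rw [abs_mul]; exact mul_le_mul_of_nonneg_left h6 (abs_nonneg _)
  have hr := abs_le.1 hσ
  have hlin : x * F + σ * (z * H) = F * (x - z) + G * z := by rw [← hFG]; ring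
  have hFx : F * (x - z) ≥ F * (C * (1 + w₁ + w₂)) := mul_le_mul_of_nonpos_left h3 hF.le
  have hGz : G * -z ≤ G * (C * (1 + w₁ + w₂)) := mul_le_mul_of_nonneg_left h4 hG.le
  have hσ0 := abs_nonneg σ
  have hlow : E ≥ d * (w₁ ^ 2 + w₂ ^ 2) - D * (1 + w₁ + w₂) := by
    have a1 : d * w₁ ^ 2 ≤ 1 / 2 * w₁ ^ 2 := by gcongr
    have a2 : d * w₂ ^ 2 ≤ c * w₂ ^ 2 := by gcongr
    have a3 : C * w₁ ≤ C * (1 + w₁ + w₂) := by gcongr; linarith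
    have a4 : |σ| * (C * w₂) ≤ |σ| * (C * (1 + w₁ + w₂)) := by gcongr; linarith
    have a7 : D * (1 + w₁ + w₂) = C * (1 + w₁ + w₂) + |σ| * (C * (1 + w₁ + w₂))
      - F * (C * (1 + w₁ + w₂)) + G * (C * (1 + w₁ + w₂)) := by rw [hD]; ring
    rw [a7, hE]
    generalize C * (1 + w₁ + w₂) = Y at *
    linarith
  have hsq : ∀ w : ℝ, D * w ≤ d / 2 * w ^ 2 + D ^ 2 / d / 2 := fun w => by
    have : 0 ≤ (d * w - D) ^ 2 / d / 2 := by positivity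
    have e1 : (d * w - D) ^ 2 / d / 2 = d / 2 * w ^ 2 + D ^ 2 / d / 2 - D * w := by
      field_simp; ring
    linarith
  have hlow2 : E ≥ d / 2 * (w₁ ^ 2 + w₂ ^ 2) - D - D ^ 2 / d := by
    have i1 := hsq w₁
    have i2 := hsq w₂
    linarith only [i1, i2, hlow]
  refine ⟨?_, fun hEe => ?_⟩
  · have : 0 ≤ d / 2 * (w₁ ^ 2 + w₂ ^ 2) := by positivity
    linarith
  have hww : d / 2 * (w₁ ^ 2 + w₂ ^ 2) ≤ T := by
    rw [hT]; linarith [le_abs_self e]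
  have hww' : w₁ ^ 2 + w₂ ^ 2 ≤ 2 * T / d := by
    rw [le_div_iff₀ hd0]; linarith
  have b1 : w₁ ≤ R := by rw [hR]; linarith [two_mul_le_add_sq w₁ 1, sq_nonneg w₁, sq_nonneg w₂]
  have b2 : w₂ ≤ R := by rw [hR]; linarith [two_mul_le_add_sq w₂ 1, sq_nonneg w₁, sq_nonneg w₂]
  have hCs' : C * (1 + w₁ + w₂) ≤ C * s := mul_le_mul_of_nonneg_left (by rw [hs]; linarith) hC
  have hup : F * (x - z) + G * z ≤ T2 := by
    have c1 : C * w₁ ≤ C * R := by gcongr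
    have c2 : |σ| * (C * w₂) ≤ |σ| * (C * R) := by gcongr
    have c3 : 0 ≤ 1 / 2 * w₁ ^ 2 := by positivity
    have c4 : 0 ≤ c * w₂ ^ 2 := by positivity
    have c5 : T2 = |e| + C * R + |σ| * (C * R) := by rw [hT2]; ring
    linarith [le_abs_self e]
  have hz1 : -z ≤ C * s := h4.trans hCs'
  have hx1 : x - z ≤ C * s := h3.trans hCs'
  have hz2 : z ≤ R3 := by
    have j1 := mul_le_mul_of_nonpos_left hx1 hF.le
    rw [hR3, le_div_iff₀ hG]; linarith only [j1, hup]
  have hx2 : -(x - z) ≤ R4 := by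
    have j1 := mul_le_mul_of_nonneg_left hz1 hG.le
    rw [hR4, le_div_iff₀ hF']; linarith only [j1, hup]
  refine ⟨by linarith only [b1, hR30, hR40, hCs], by linarith only [b2, hR30, hR40, hCs],
    abs_le.2 ⟨by linarith only [hx2, hz1, hR0, hR30, hCs], by linarith only [hx1, hz2, hR0, hR40, hCs]⟩,
    abs_le.2 ⟨by linarith only [hz1, hR0, hR30, hR40, hCs], by linarith only [hz2, hR0, hR40, hCs]⟩⟩

/-- The data of the relaxed minimization problem: the weight, the sources `f`, `h`, the potentials
`U`, `V`, and the coefficients of the functional and of the constraints. -/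
structure Problem where
  (h₀ f h U V : Plane → ℝ)
  (c σ γ a b : ℝ)
  weight : IsWeight h₀
  continuous_f : Continuous f
  hasCompactSupport_f : HasCompactSupport f
  continuous_h : Continuous h
  hasCompactSupport_h : HasCompactSupport h
  continuous_U : Continuous U
  continuous_V : Continuous V
  U_nonneg : ∀ x, 0 ≤ U x
  V_nonneg : ∀ x, 0 ≤ V x
  exists_finite_U : ∃ S : Set Plane, S.Finite ∧ ∀ x ∉ S, 0 < U x
  exists_finite_V : ∃ S : Set Plane, S.Finite ∧ ∀ x ∉ S, 0 < V x
  integrable_U : Integrable U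
  integrable_V : Integrable V
  integrable_log_U : Integrable (fun x => Real.log (U x)) (wMeasure h₀)
  integrable_log_V : Integrable (fun x => Real.log (V x)) (wMeasure h₀)
  c_pos : 0 < c
  γ_pos : 0 < γ
  a_pos : 0 < a
  b_pos : 0 < b
  integral_f_neg : ∫ x, f x < 0
  integral_add_pos : 0 < (∫ x, f x) + σ * ∫ x, h x

namespace Problem

variable (P : Problem)

/-- Finite-energy pairs satisfying the relaxed (inequality) constraints. -/
structure Feasible (ξ : Plane → ℝ) (W₁ : Plane → Plane) (ζ : Plane → ℝ) (W₂ : Plane → Plane) :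
    Prop where
  left : WeakH P.h₀ ξ W₁
  right : WeakH P.h₀ ζ W₂
  expMass_V : expMass P.V (fun x => (ξ x - ζ x) / 2) ≤ ENNReal.ofReal P.a
  expMass_U : expMass P.U (fun x => -P.γ * ζ x) ≤ ENNReal.ofReal P.b

/-- The action functional on weakly differentiable pairs. -/
def energy (ξ : Plane → ℝ) (W₁ : Plane → Plane) (ζ : Plane → ℝ) (W₂ : Plane → Plane) : ℝ :=
  1 / 2 * (∫ x, ‖W₁ x‖ ^ 2) + P.c * (∫ x, ‖W₂ x‖ ^ 2) + (∫ x, ξ x * P.f x)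
    + P.σ * ∫ x, ζ x * P.h x

variable {P} in
lemma Feasible.integrable_V {ξ ζ : Plane → ℝ} {W₁ W₂ : Plane → Plane}
    (h : P.Feasible ξ W₁ ζ W₂) :
    Integrable fun x => P.V x * Real.exp ((ξ x - ζ x) / 2) := by
  have h1 := (P.weight.locallyIntegrable h.left.memLp).aestronglyMeasurable
  have h2 := (P.weight.locallyIntegrable h.right.memLp).aestronglyMeasurable
  exact integrable_of_expMass_lt_top P.continuous_V P.V_nonneg
    ((h1.sub h2).mul_const (2⁻¹ : ℝ) |>.congr (Eventually.of_forall fun x => by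
      simp [div_eq_mul_inv])) (h.expMass_V.trans_lt ENNReal.ofReal_lt_top).ne

variable {P} in
lemma Feasible.integrable_U {ξ ζ : Plane → ℝ} {W₁ W₂ : Plane → Plane}
    (h : P.Feasible ξ W₁ ζ W₂) : Integrable fun x => P.U x * Real.exp (-P.γ * ζ x) := by
  have h2 := (P.weight.locallyIntegrable h.right.memLp).aestronglyMeasurable
  exact integrable_of_expMass_lt_top P.continuous_U P.U_nonneg
    (h2.const_mul (-P.γ)) (h.expMass_U.trans_lt ENNReal.ofReal_lt_top).ne

theorem coercive : ∃ B : ℝ, ∀ e : ℝ, ∃ R : ℝ, ∀ ξ W₁ ζ W₂, P.Feasible ξ W₁ ζ W₂ →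
    B ≤ P.energy ξ W₁ ζ W₂ ∧ (P.energy ξ W₁ ζ W₂ ≤ e →
      l2norm (wMeasure P.h₀) ξ ≤ R ∧ l2norm volume W₁ ≤ R ∧ l2norm (wMeasure P.h₀) ζ ≤ R ∧
      l2norm volume W₂ ≤ R) := by
  obtain ⟨K⟩ := DyadicKernel.nonempty
  have hfin := P.weight.isFiniteMeasure
  obtain ⟨SU, hSU, hU⟩ := P.exists_finite_U
  obtain ⟨SV, hSV, hV⟩ := P.exists_finite_V
  obtain ⟨C1, hC1, hf⟩ := P.weight.exists_abs_integral_mul_sub_le K P.continuous_f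
    P.hasCompactSupport_f
  obtain ⟨C2, hC2, hh⟩ := P.weight.exists_abs_integral_mul_sub_le K P.continuous_h
    P.hasCompactSupport_h
  obtain ⟨C3, hC3, hm⟩ := P.weight.exists_abs_integral_sub_le K
  obtain ⟨C4, hC4, hn⟩ := P.weight.exists_l2norm_le K
  obtain ⟨C5, hJV⟩ := P.weight.exists_integral_le P.V_nonneg hSV hV P.integrable_log_V P.a
  obtain ⟨C6, hJU⟩ := P.weight.exists_integral_le P.U_nonneg hSU hU P.integrable_log_U P.b
  set m := (wMeasure P.h₀).real Set.univ with hmdef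
  have hm0 : 0 < m := by
    refine ENNReal.toReal_pos (fun h0 => ?_) (measure_ne_top _ _)
    have := P.weight.volume_ac h0
    simp at this
  have hγ := P.γ_pos
  set C := C1 + C2 + (2 * |C5| + C3) / m + (|C6| / P.γ + C3) / m with hC
  have p1 : 0 ≤ (2 * |C5| + C3) / m := by positivity
  have p2 : 0 ≤ (|C6| / P.γ + C3) / m := by positivity
  have hC0 : 0 ≤ C := by positivity
  obtain ⟨B, hB⟩ := real_coercivity (σ := P.σ) P.integral_f_neg P.integral_add_pos rfl P.c_pos hC0
  refine ⟨B, fun e => ?_⟩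
  obtain ⟨R, hR⟩ := hB e
  refine ⟨max R (C4 * (R + R)), fun ξ W₁ ζ W₂ hfeas => ?_⟩
  set w₁ := l2norm volume W₁ with hw1
  set w₂ := l2norm volume W₂ with hw2
  have hw10 : 0 ≤ w₁ := l2norm_nonneg _ _
  have hw20 : 0 ≤ w₂ := l2norm_nonneg _ _
  have iξ := hfeas.left.memLp.integrable one_le_two
  have iζ := hfeas.right.memLp.integrable one_le_two
  have mξ := abs_le.1 (hm ξ W₁ hfeas.left)
  have mζ := abs_le.1 (hm ζ W₂ hfeas.right)
  have j1 : ∫ x, (ξ x - ζ x) / 2 ∂(wMeasure P.h₀) ≤ C5 :=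
    hJV _ ((iξ.sub iζ).div_const 2) hfeas.integrable_V
      ((expMass_le_iff P.V_nonneg hfeas.integrable_V P.a_pos.le).1 hfeas.expMass_V)
  have j2 : ∫ x, -P.γ * ζ x ∂(wMeasure P.h₀) ≤ C6 :=
    hJU _ (iζ.const_mul _) hfeas.integrable_U
      ((expMass_le_iff P.U_nonneg hfeas.integrable_U P.b_pos.le).1 hfeas.expMass_U)
  rw [integral_div, integral_sub iξ iζ] at j1
  rw [integral_const_mul] at j2
  have j2' : -∫ x, ζ x ∂(wMeasure P.h₀) ≤ |C6| / P.γ := by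
    rw [le_div_iff₀ hγ]; linarith [le_abs_self C6]
  have s1 : 0 ≤ w₁ + w₂ := by positivity
  have a1 : K.mean ξ - K.mean ζ ≤ C * (1 + w₁ + w₂) := by
    have : K.mean ξ - K.mean ζ ≤ (2 * |C5| + C3) / m * (1 + w₁ + w₂) := by
      rw [div_mul_eq_mul_div, le_div_iff₀ hm0]
      have := mul_nonneg (abs_nonneg C5) s1
      nlinarith [le_abs_self C5]
    refine this.trans (mul_le_mul_of_nonneg_right ?_ (by positivity))
    rw [hC]; linarith
  have a2 : -K.mean ζ ≤ C * (1 + w₁ + w₂) := by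
    have : -K.mean ζ ≤ (|C6| / P.γ + C3) / m * (1 + w₁ + w₂) := by
      rw [div_mul_eq_mul_div, le_div_iff₀ hm0]
      have t1 : 0 ≤ |C6| / P.γ := by positivity
      have := mul_nonneg t1 s1
      nlinarith [mul_nonneg hC3 hw10]
    refine this.trans (mul_le_mul_of_nonneg_right ?_ (by positivity))
    rw [hC]; linarith
  have a3 := (hf ξ W₁ hfeas.left).trans (mul_le_mul_of_nonneg_right (show C1 ≤ C by
    rw [hC]; linarith) hw10)
  have a4 := (hh ζ W₂ hfeas.right).trans (mul_le_mul_of_nonneg_right (show C2 ≤ C by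
    rw [hC]; linarith) hw20)
  have hE : P.energy ξ W₁ ζ W₂ = 1 / 2 * w₁ ^ 2 + P.c * w₂ ^ 2 + (∫ x, ξ x * P.f x)
      + P.σ * ∫ x, ζ x * P.h x := by
    rw [energy, integral_norm_sq_eq hfeas.left.memLp_grad, integral_norm_sq_eq hfeas.right.memLp_grad]
  obtain ⟨q1, q2⟩ := hR w₁ w₂ (K.mean ξ) (K.mean ζ) _ _ _ hw10 hw20 a1 a2 a3 a4 hE
  refine ⟨q1, fun hle => ?_⟩
  obtain ⟨r1, r2, r3, r4⟩ := q2 hle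
  refine ⟨?_, r1.trans (le_max_left _ _), ?_, r2.trans (le_max_left _ _)⟩
  · exact ((hn ξ W₁ hfeas.left).trans
      (mul_le_mul_of_nonneg_left (add_le_add r1 r3) hC4)).trans (le_max_right _ _)
  · exact ((hn ζ W₂ hfeas.right).trans
      (mul_le_mul_of_nonneg_left (add_le_add r2 r4) hC4)).trans (le_max_right _ _)

lemma exists_feasible : ∃ ξ W₁ ζ W₂, P.Feasible ξ W₁ ζ W₂ := by
  have hfin := P.weight.isFiniteMeasure
  have key : ∀ (V : Plane → ℝ), Integrable V → (∀ x, 0 ≤ V x) → ∀ A : ℝ, 0 < A →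
      ∃ t : ℝ, expMass V (fun _ => t) ≤ ENNReal.ofReal A := by
    intro V hV hVn A hA
    have h0 : 0 ≤ ∫ x, V x := integral_nonneg hVn
    refine ⟨Real.log (A / ((∫ x, V x) + 1)), ?_⟩
    refine expMass_le_of_integral_le hVn (hV.mul_const _) ?_
    rw [integral_mul_const, Real.exp_log (by positivity), ← mul_div_assoc,
      div_le_iff₀ (by positivity)]
    nlinarith
  obtain ⟨s, hs⟩ := key P.V P.integrable_V P.V_nonneg P.a P.a_pos
  obtain ⟨t, ht⟩ := key P.U P.integrable_U P.U_nonneg P.b P.b_pos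
  have hw : ∀ r : ℝ, WeakH P.h₀ (fun _ => r) (fun _ => 0) := fun r =>
    ⟨memLp_const r, MemLp.zero', by
      simpa using isWeakGrad_zero.add_const (locallyIntegrable_const 0) r⟩
  refine ⟨_, _, _, _, hw (2 * s - t / P.γ), hw (-t / P.γ), ?_, ?_⟩
  · convert hs using 3
    ring
  · convert ht using 3
    have := P.γ_pos.ne'
    field_simp

end Problem

/-- Pairs (function, gradient) in the natural Hilbert space. -/
abbrev GradPair (h₀ : Plane → ℝ) : Type :=
  WithLp 2 (Lp ℝ 2 (wMeasure h₀) × Lp Plane 2 (volume : Measure Plane))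

/-- The function component of a pair. -/
def GradPair.fn (h₀ : Plane → ℝ) : GradPair h₀ →L[ℝ] Lp ℝ 2 (wMeasure h₀) :=
  WithLp.fstL 2 ℝ (Lp ℝ 2 (wMeasure h₀)) (Lp Plane 2 (volume : Measure Plane))

/-- The gradient component of a pair. -/
def GradPair.grad (h₀ : Plane → ℝ) : GradPair h₀ →L[ℝ] Lp Plane 2 (volume : Measure Plane) :=
  WithLp.sndL 2 ℝ (Lp ℝ 2 (wMeasure h₀)) (Lp Plane 2 (volume : Measure Plane))

lemma GradPair.norm_sq {h₀ : Plane → ℝ} (z : GradPair h₀) :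
    ‖z‖ ^ 2 = ‖fn h₀ z‖ ^ 2 + ‖grad h₀ z‖ ^ 2 := WithLp.prod_norm_sq_eq_of_L2 z

lemma IsWeight.isClosed_gradPair {h₀ : Plane → ℝ} (hw : IsWeight h₀) :
    IsClosed {z : GradPair h₀ | IsWeakGrad (GradPair.fn h₀ z) (GradPair.grad h₀ z)} :=
  hw.isClosed_isWeakGrad.preimage
    (((GradPair.fn h₀).continuous.prodMk (GradPair.grad h₀).continuous))

lemma IsWeight.convex_gradPair {h₀ : Plane → ℝ} (hw : IsWeight h₀) :
    Convex ℝ {z : GradPair h₀ | IsWeakGrad (GradPair.fn h₀ z) (GradPair.grad h₀ z)} := by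
  intro z hz z' hz' a b ha hb hab
  have h := IsWeakGrad.linear_comb (hw.locallyIntegrable (Lp.memLp (GradPair.fn h₀ z)))
    (hw.locallyIntegrable (Lp.memLp (GradPair.fn h₀ z')))
    ((Lp.memLp (GradPair.grad h₀ z)).locallyIntegrable (by norm_num))
    ((Lp.memLp (GradPair.grad h₀ z')).locallyIntegrable (by norm_num)) hz hz' a b
  refine h.congr ?_ ?_
  · rw [map_add, map_smul, map_smul]
    filter_upwards [hw.volume_ac (Lp.coeFn_add (a • GradPair.fn h₀ z) (b • GradPair.fn h₀ z')),
      hw.volume_ac (Lp.coeFn_smul a (GradPair.fn h₀ z)),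
      hw.volume_ac (Lp.coeFn_smul b (GradPair.fn h₀ z'))] with x h1 h2 h3
    refine Eq.trans ?_ h1.symm
    rw [Pi.add_apply, h2, h3]
    rfl
  · rw [map_add, map_smul, map_smul]
    filter_upwards [Lp.coeFn_add (a • GradPair.grad h₀ z) (b • GradPair.grad h₀ z'),
      Lp.coeFn_smul a (GradPair.grad h₀ z),
      Lp.coeFn_smul b (GradPair.grad h₀ z')] with x h1 h2 h3
    refine Eq.trans ?_ h1.symm
    rw [Pi.add_apply, h2, h3]
    rfl

lemma IsWeight.isLinearMap_integral_mul {h₀ : Plane → ℝ} (hw : IsWeight h₀) {φ : Plane → ℝ}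
    (hφ : Continuous φ) (hφs : HasCompactSupport φ) :
    IsLinearMap ℝ fun u : Lp ℝ 2 (wMeasure h₀) => ∫ x, u x * φ x := by
  constructor
  · intro u v
    rw [← integral_add
      (integrable_mul_of_hasCompactSupport (hw.locallyIntegrable (Lp.memLp u)) hφ hφs)
      (integrable_mul_of_hasCompactSupport (hw.locallyIntegrable (Lp.memLp v)) hφ hφs)]
    refine integral_congr_ae ?_
    filter_upwards [hw.volume_ac (Lp.coeFn_add u v)] with x hx
    rw [hx, Pi.add_apply, add_mul]
  · intro s u
    rw [smul_eq_mul, ← integral_const_mul]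
    refine integral_congr_ae ?_
    filter_upwards [hw.volume_ac (Lp.coeFn_smul s u)] with x hx
    simp [hx, mul_assoc]

lemma norm_eq_l2norm {E : Type*} [NormedAddCommGroup E] {ν : Measure Plane} (u : Lp E 2 ν) :
    ‖u‖ = l2norm ν u := Lp.norm_def u

lemma convexOn_norm_sq {E : Type*} [NormedAddCommGroup E] [NormedSpace ℝ E] :
    ConvexOn ℝ Set.univ fun x : E => ‖x‖ ^ 2 :=
  convexOn_univ_norm.pow (fun _ _ => norm_nonneg _) 2

namespace Problem

variable (P : Problem)

/-- The Hilbert space carrying the minimization problem. -/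
abbrev Space : Type := WithLp 2 (GradPair P.h₀ × GradPair P.h₀)

/-- The first pair. -/
def left : P.Space →L[ℝ] GradPair P.h₀ := WithLp.fstL 2 ℝ (GradPair P.h₀) (GradPair P.h₀)

/-- The second pair. -/
def right : P.Space →L[ℝ] GradPair P.h₀ := WithLp.sndL 2 ℝ (GradPair P.h₀) (GradPair P.h₀)

lemma norm_sq_eq (z : P.Space) : ‖z‖ ^ 2 = ‖P.left z‖ ^ 2 + ‖P.right z‖ ^ 2 :=
  WithLp.prod_norm_sq_eq_of_L2 z

/-- The function whose exponential enters the first constraint. -/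
def exponentV : P.Space →L[ℝ] Lp ℝ 2 (wMeasure P.h₀) :=
  (1 / 2 : ℝ) • (GradPair.fn P.h₀ ∘L P.left - GradPair.fn P.h₀ ∘L P.right)

/-- The function whose exponential enters the second constraint. -/
def exponentU : P.Space →L[ℝ] Lp ℝ 2 (wMeasure P.h₀) :=
  (-P.γ) • (GradPair.fn P.h₀ ∘L P.right)

/-- The feasible set, as a subset of the Hilbert space. -/
def feasibleSet : Set P.Space :=
  (P.left ⁻¹' {z | IsWeakGrad (GradPair.fn P.h₀ z) (GradPair.grad P.h₀ z)} ∩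
    P.right ⁻¹' {z | IsWeakGrad (GradPair.fn P.h₀ z) (GradPair.grad P.h₀ z)}) ∩
  (P.exponentV ⁻¹' {w | expMass P.V w ≤ ENNReal.ofReal P.a} ∩
    P.exponentU ⁻¹' {w | expMass P.U w ≤ ENNReal.ofReal P.b})

lemma mem_feasibleSet_iff (z : P.Space) :
    z ∈ P.feasibleSet ↔ P.Feasible (GradPair.fn P.h₀ (P.left z)) (GradPair.grad P.h₀ (P.left z))
      (GradPair.fn P.h₀ (P.right z)) (GradPair.grad P.h₀ (P.right z)) := by
  have hV : ⇑(P.exponentV z) =ᵐ[volume] fun x =>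
      ((GradPair.fn P.h₀ (P.left z) : Plane → ℝ) x - GradPair.fn P.h₀ (P.right z) x) / 2 := by
    filter_upwards [P.weight.volume_ac (Lp.coeFn_smul (1 / 2 : ℝ)
        (GradPair.fn P.h₀ (P.left z) - GradPair.fn P.h₀ (P.right z))),
      P.weight.volume_ac
        (Lp.coeFn_sub (GradPair.fn P.h₀ (P.left z)) (GradPair.fn P.h₀ (P.right z)))] with x h1 h2
    refine h1.trans ?_
    rw [Pi.smul_apply, h2, Pi.sub_apply, smul_eq_mul]
    ring
  have hU : ⇑(P.exponentU z) =ᵐ[volume] fun x => -P.γ * GradPair.fn P.h₀ (P.right z) x :=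
    P.weight.volume_ac (Lp.coeFn_smul (-P.γ) (GradPair.fn P.h₀ (P.right z)))
  constructor
  · rintro ⟨⟨h1, h2⟩, h3, h4⟩
    exact ⟨⟨Lp.memLp _, Lp.memLp _, h1⟩, ⟨Lp.memLp _, Lp.memLp _, h2⟩,
      (expMass_congr hV).symm.trans_le h3, (expMass_congr hU).symm.trans_le h4⟩
  · rintro ⟨h1, h2, h3, h4⟩
    exact ⟨⟨h1.isWeakGrad, h2.isWeakGrad⟩, (expMass_congr hV).trans_le h3,
      (expMass_congr hU).trans_le h4⟩

lemma isClosed_feasibleSet : IsClosed P.feasibleSet :=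
  ((P.weight.isClosed_gradPair.preimage P.left.continuous).inter
    (P.weight.isClosed_gradPair.preimage P.right.continuous)).inter
  (((P.weight.isClosed_expMass_le P.continuous_V _).preimage P.exponentV.continuous).inter
    ((P.weight.isClosed_expMass_le P.continuous_U _).preimage P.exponentU.continuous))

lemma convex_feasibleSet : Convex ℝ P.feasibleSet :=
  ((P.weight.convex_gradPair.linear_preimage P.left.toLinearMap).inter
    (P.weight.convex_gradPair.linear_preimage P.right.toLinearMap)).inter
  (((P.weight.convex_expMass_le P.continuous_V P.V_nonneg _).linear_preimage
      P.exponentV.toLinearMap).inter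
    ((P.weight.convex_expMass_le P.continuous_U P.U_nonneg _).linear_preimage
      P.exponentU.toLinearMap))

/-- The action functional on the Hilbert space. -/
def action (z : P.Space) : ℝ :=
  P.energy (GradPair.fn P.h₀ (P.left z)) (GradPair.grad P.h₀ (P.left z))
    (GradPair.fn P.h₀ (P.right z)) (GradPair.grad P.h₀ (P.right z))

lemma action_eq (z : P.Space) : P.action z =
    1 / 2 * ‖GradPair.grad P.h₀ (P.left z)‖ ^ 2 + P.c * ‖GradPair.grad P.h₀ (P.right z)‖ ^ 2
      + (∫ x, GradPair.fn P.h₀ (P.left z) x * P.f x)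
      + P.σ * ∫ x, GradPair.fn P.h₀ (P.right z) x * P.h x := by
  rw [action, energy, integral_norm_sq_eq (Lp.memLp _), integral_norm_sq_eq (Lp.memLp _),
    ← norm_eq_l2norm, ← norm_eq_l2norm]

lemma continuous_action : Continuous P.action := by
  have h1 := (P.weight.continuous_integral_mul P.continuous_f P.hasCompactSupport_f).comp
    ((GradPair.fn P.h₀).continuous.comp P.left.continuous)
  have h2 := (P.weight.continuous_integral_mul P.continuous_h P.hasCompactSupport_h).comp
    ((GradPair.fn P.h₀).continuous.comp P.right.continuous)
  have h3 := ((GradPair.grad P.h₀).continuous.comp P.left.continuous).norm.pow 2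
  have h4 := ((GradPair.grad P.h₀).continuous.comp P.right.continuous).norm.pow 2
  rw [show P.action = _ from funext P.action_eq]
  exact (((continuous_const.mul h3).add (continuous_const.mul h4)).add h1).add
    (continuous_const.mul h2)

lemma convexOn_action : ConvexOn ℝ Set.univ P.action := by
  have h3 := (convexOn_norm_sq (E := Lp Plane 2 (volume : Measure Plane))).comp_linearMap
    (GradPair.grad P.h₀ ∘L P.left).toLinearMap
  have h4 := (convexOn_norm_sq (E := Lp Plane 2 (volume : Measure Plane))).comp_linearMap
    (GradPair.grad P.h₀ ∘L P.right).toLinearMap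
  have h5 := ((IsLinearMap.mk' _ (P.weight.isLinearMap_integral_mul P.continuous_f
    P.hasCompactSupport_f)).comp (GradPair.fn P.h₀ ∘L P.left).toLinearMap).convexOn convex_univ
  have h6 := (P.σ • (IsLinearMap.mk' _ (P.weight.isLinearMap_integral_mul P.continuous_h
    P.hasCompactSupport_h)).comp (GradPair.fn P.h₀ ∘L P.right).toLinearMap).convexOn convex_univ
  rw [show P.action = _ from funext P.action_eq]
  exact (((h3.smul (by norm_num : (0 : ℝ) ≤ 1 / 2)).add (h4.smul P.c_pos.le)).add h5).add h6

variable {P} in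
/-- The element of the Hilbert space attached to a pair of functions of finite energy. -/
def mkSpace {ξ ζ : Plane → ℝ} {W₁ W₂ : Plane → Plane} (h : P.Feasible ξ W₁ ζ W₂) : P.Space :=
  WithLp.toLp 2 (WithLp.toLp 2 (h.left.memLp.toLp, h.left.memLp_grad.toLp),
    WithLp.toLp 2 (h.right.memLp.toLp, h.right.memLp_grad.toLp))

variable {P} in
lemma Feasible.congr {ξ ζ ξ' ζ' : Plane → ℝ} {W₁ W₂ W₁' W₂' : Plane → Plane}
    (h : P.Feasible ξ W₁ ζ W₂) (h1 : ξ =ᵐ[volume] ξ') (h2 : W₁ =ᵐ[volume] W₁')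
    (h3 : ζ =ᵐ[volume] ζ') (h4 : W₂ =ᵐ[volume] W₂') : P.Feasible ξ' W₁' ζ' W₂' where
  left := ⟨h.left.memLp.ae_eq (IsWeight.ac_volume.ae_eq h1), h.left.memLp_grad.ae_eq h2,
    h.left.isWeakGrad.congr h1 h2⟩
  right := ⟨h.right.memLp.ae_eq (IsWeight.ac_volume.ae_eq h3), h.right.memLp_grad.ae_eq h4,
    h.right.isWeakGrad.congr h3 h4⟩
  expMass_V := (expMass_congr (by filter_upwards [h1, h3] with x e1 e3; rw [e1, e3])).trans_le
    h.expMass_V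
  expMass_U := (expMass_congr (by filter_upwards [h3] with x e3; rw [e3])).trans_le h.expMass_U

lemma energy_congr {ξ ζ ξ' ζ' : Plane → ℝ} {W₁ W₂ W₁' W₂' : Plane → Plane}
    (h1 : ξ =ᵐ[volume] ξ') (h2 : W₁ =ᵐ[volume] W₁') (h3 : ζ =ᵐ[volume] ζ')
    (h4 : W₂ =ᵐ[volume] W₂') : P.energy ξ W₁ ζ W₂ = P.energy ξ' W₁' ζ' W₂' := by
  have e1 : ∫ x, ‖W₁ x‖ ^ 2 = ∫ x, ‖W₁' x‖ ^ 2 :=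
    integral_congr_ae (by filter_upwards [h2] with x hx; rw [hx])
  have e2 : ∫ x, ‖W₂ x‖ ^ 2 = ∫ x, ‖W₂' x‖ ^ 2 :=
    integral_congr_ae (by filter_upwards [h4] with x hx; rw [hx])
  have e3 : ∫ x, ξ x * P.f x = ∫ x, ξ' x * P.f x :=
    integral_congr_ae (by filter_upwards [h1] with x hx; rw [hx])
  have e4 : ∫ x, ζ x * P.h x = ∫ x, ζ' x * P.h x :=
    integral_congr_ae (by filter_upwards [h3] with x hx; rw [hx])
  rw [energy, energy, e1, e2, e3, e4]

lemma mkSpace_spec {ξ ζ : Plane → ℝ} {W₁ W₂ : Plane → Plane} (h : P.Feasible ξ W₁ ζ W₂) :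
    mkSpace h ∈ P.feasibleSet ∧ P.action (mkSpace h) = P.energy ξ W₁ ζ W₂ := by
  have h1 : ⇑h.left.memLp.toLp =ᵐ[volume] ξ := P.weight.volume_ac h.left.memLp.coeFn_toLp
  have h2 := h.left.memLp_grad.coeFn_toLp
  have h3 : ⇑h.right.memLp.toLp =ᵐ[volume] ζ := P.weight.volume_ac h.right.memLp.coeFn_toLp
  have h4 := h.right.memLp_grad.coeFn_toLp
  exact ⟨(P.mem_feasibleSet_iff _).2 (h.congr h1.symm h2.symm h3.symm h4.symm),
    P.energy_congr h1 h2 h3 h4⟩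

lemma exists_isMinOn_action : ∃ z ∈ P.feasibleSet, ∀ y ∈ P.feasibleSet,
    P.action z ≤ P.action y := by
  obtain ⟨B, hB⟩ := P.coercive
  refine exists_isMinOn_of_convexOn ?_ P.isClosed_feasibleSet
    (P.convexOn_action.subset (Set.subset_univ _) P.convex_feasibleSet) P.continuous_action ?_ ?_
  · obtain ⟨ξ, W₁, ζ, W₂, h⟩ := P.exists_feasible
    exact ⟨mkSpace h, (P.mkSpace_spec h).1⟩
  · refine ⟨B, ?_⟩
    rintro _ ⟨z, hz, rfl⟩
    obtain ⟨R, hR⟩ := hB 0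
    exact (hR _ _ _ _ ((P.mem_feasibleSet_iff z).1 hz)).1
  · intro e
    obtain ⟨R, hR⟩ := hB e
    refine ⟨√(R ^ 2 + R ^ 2 + (R ^ 2 + R ^ 2)), fun z hz hle => ?_⟩
    obtain ⟨h1, h2, h3, h4⟩ := (hR _ _ _ _ ((P.mem_feasibleSet_iff z).1 hz)).2 hle
    refine Real.le_sqrt_of_sq_le ?_
    rw [P.norm_sq_eq, GradPair.norm_sq, GradPair.norm_sq]
    simp only [norm_eq_l2norm]
    gcongr <;> exact l2norm_nonneg _ _

theorem exists_minimizer : ∃ ξ W₁ ζ W₂, P.Feasible ξ W₁ ζ W₂ ∧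
    ∀ ξ' W₁' ζ' W₂', P.Feasible ξ' W₁' ζ' W₂' →
      P.energy ξ W₁ ζ W₂ ≤ P.energy ξ' W₁' ζ' W₂' := by
  obtain ⟨z, hz, hmin⟩ := P.exists_isMinOn_action
  refine ⟨_, _, _, _, (P.mem_feasibleSet_iff z).1 hz, fun ξ W₁ ζ W₂ h => ?_⟩
  rw [← (P.mkSpace_spec h).2]
  exact hmin _ (P.mkSpace_spec h).1

end Problem

lemma memH_of_hasCompactSupport {h₀ φ : Plane → ℝ} (hw : IsWeight h₀) (hφ : ContDiff ℝ 1 φ)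
    (hφs : HasCompactSupport φ) : MemH h₀ φ := by
  have := hw.isFiniteMeasure
  have hc : Continuous (gradient φ) :=
    (InnerProductSpace.toDual ℝ Plane).symm.continuous.comp (hφ.continuous_fderiv one_ne_zero)
  have hs : HasCompactSupport (gradient φ) := by
    refine (hφs.fderiv (𝕜 := ℝ)).mono fun x hx => ?_
    rw [Function.mem_support] at hx ⊢
    contrapose! hx
    rw [gradient, hx, map_zero]
  have hs1 : HasCompactSupport fun x => ‖gradient φ x‖ ^ 2 :=
    hs.comp_left (g := fun v => ‖v‖ ^ 2) (by simp)
  have hs2 : HasCompactSupport fun x => φ x ^ 2 := hφs.comp_left (g := fun v => v ^ 2) (by simp)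
  exact ⟨hφ.differentiable one_ne_zero, (hc.norm.pow 2).integrable_of_hasCompactSupport hs1,
    (hφ.continuous.pow 2).integrable_of_hasCompactSupport hs2⟩

lemma WeakH.perturb {h₀ u φ : Plane → ℝ} {W : Plane → Plane} (hw : IsWeight h₀)
    (hu : WeakH h₀ u W) (hφ : MemH h₀ φ) (t s : ℝ) :
    WeakH h₀ (fun x => u x + t * φ x + s) (fun x => W x + t • gradient φ x) := by
  have := hw.isFiniteMeasure
  have hφ' := hφ.weakH
  have hm : MemLp (fun x => u x + t * φ x) 2 (wMeasure h₀) := hu.memLp.add (hφ'.memLp.const_mul t)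
  refine ⟨hm.add (memLp_const s), hu.memLp_grad.add (hφ'.memLp_grad.const_smul t), ?_⟩
  refine IsWeakGrad.add_const (hw.locallyIntegrable hm) ?_ s
  have := IsWeakGrad.linear_comb (hw.locallyIntegrable hu.memLp) (hw.locallyIntegrable hφ'.memLp)
    (hu.memLp_grad.locallyIntegrable one_le_two) (hφ'.memLp_grad.locallyIntegrable one_le_two)
    hu.isWeakGrad hφ'.isWeakGrad 1 t
  simpa only [one_mul, one_smul] using this

lemma integral_add_add {f₁ f₂ f₃ : Plane → ℝ} (h₁ : Integrable f₁) (h₂ : Integrable f₂)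
    (h₃ : Integrable f₃) :
    ∫ x, (f₁ x + f₂ x + f₃ x) = (∫ x, f₁ x) + (∫ x, f₂ x) + ∫ x, f₃ x := by
  rw [integral_add (f := fun x => f₁ x + f₂ x) (h₁.add h₂) h₃, integral_add h₁ h₂]

lemma integrable_fderiv_apply {φ : Plane → ℝ} {W : Plane → Plane} (hW : MemLp W 2)
    (hφ : MemLp (gradient φ) 2) : Integrable fun x => fderiv ℝ φ x (W x) := by
  refine (hφ.norm.integrable_mul hW.norm).mono' ?_ (Eventually.of_forall fun x => ?_)
  · simpa only [inner_gradient_eq] using hφ.1.inner (𝕜 := ℝ) hW.1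
  · rw [← inner_gradient_eq]
    exact norm_inner_le_norm _ _

lemma integral_norm_sq_perturb {φ : Plane → ℝ} {W : Plane → Plane} (hW : MemLp W 2)
    (hφ : MemLp (gradient φ) 2) (t : ℝ) :
    ∫ x, ‖W x + t • gradient φ x‖ ^ 2
      = (∫ x, ‖W x‖ ^ 2) + 2 * t * (∫ x, fderiv ℝ φ x (W x)) + t ^ 2 * ∫ x, ‖gradient φ x‖ ^ 2 := by
  have h1 := (memLp_two_iff_integrable_sq_norm hW.1).1 hW
  have h2 := integrable_fderiv_apply hW hφ
  have h3 := (memLp_two_iff_integrable_sq_norm hφ.1).1 hφ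
  rw [← integral_const_mul, ← integral_const_mul, ← integral_add_add h1 (h2.const_mul _) (h3.const_mul _)]
  refine integral_congr_ae (Eventually.of_forall fun x => ?_)
  simp only
  rw [norm_add_sq_real, inner_smul_right, real_inner_comm, inner_gradient_eq, norm_smul, mul_pow,
    Real.norm_eq_abs, sq_abs]
  ring

lemma exp_mass_perturb {m η : Plane → ℝ} {M t : ℝ} (hm : Integrable m) (hm0 : ∀ x, 0 ≤ m x)
    (hη : Continuous η) (hM : ∀ x, |η x| ≤ M) (ht : |t| * M ≤ 1) :
    Integrable (fun x => m x * Real.exp (t * η x)) ∧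
      ∫ x, m x * Real.exp (t * η x)
        ≤ (∫ x, m x) + t * (∫ x, m x * η x) + t ^ 2 * (M ^ 2 * ∫ x, m x) := by
  have hb : ∀ x, |t * η x| ≤ 1 := fun x => by
    rw [abs_mul]
    exact (mul_le_mul_of_nonneg_left (hM x) (abs_nonneg t)).trans ht
  have hi : Integrable (fun x => m x * Real.exp (t * η x)) :=
    hm.mul_bdd (c := Real.exp 1) (by fun_prop) (Eventually.of_forall fun x => by
      rw [Real.norm_eq_abs, Real.abs_exp]
      exact Real.exp_le_exp.2 ((le_abs_self _).trans (hb x)))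
  have hi2 : Integrable (fun x => m x * η x) :=
    hm.mul_bdd (c := M) hη.aestronglyMeasurable (Eventually.of_forall hM)
  refine ⟨hi, ?_⟩
  rw [← integral_const_mul, ← integral_const_mul, ← integral_const_mul,
    ← integral_add_add hm (hi2.const_mul _) ((hm.const_mul _).const_mul _)]
  refine integral_mono hi ((hm.add (hi2.const_mul _)).add ((hm.const_mul _).const_mul _))
    fun x => ?_
  have h1 := (abs_le.1 (Real.abs_exp_sub_one_sub_id_le (hb x))).2
  have h2 : (t * η x) ^ 2 ≤ t ^ 2 * M ^ 2 := by
    rw [mul_pow]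
    exact mul_le_mul_of_nonneg_left (sq_le_sq' (by linarith [(abs_le.1 (hM x)).1])
      (abs_le.1 (hM x)).2) (sq_nonneg t)
  have h3 : Real.exp (t * η x) ≤ 1 + t * η x + t ^ 2 * M ^ 2 := by linarith
  calc m x * Real.exp (t * η x) ≤ m x * (1 + t * η x + t ^ 2 * M ^ 2) :=
        mul_le_mul_of_nonneg_left h3 (hm0 x)
    _ = m x + t * (m x * η x) + t ^ 2 * (M ^ 2 * m x) := by ring

lemma eq_zero_of_quadratic_nonneg {L K δ : ℝ} (hδ : 0 < δ)
    (h : ∀ t : ℝ, |t| ≤ δ → 0 ≤ t * L + t ^ 2 * K) : L = 0 := by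
  have hmax : 0 < max |K| 1 := lt_of_lt_of_le one_pos (le_max_right _ _)
  by_contra hL
  have hL' : 0 < |L| := abs_pos.2 hL
  set τ := min δ (|L| / (2 * max |K| 1)) with hτ
  have hτ0 : 0 < τ := by positivity
  have hτδ : τ ≤ δ := min_le_left _ _
  have hτL : τ * (2 * max |K| 1) ≤ |L| := by
    rw [← le_div_iff₀ (by positivity)]; exact min_le_right _ _
  have hK : τ ^ 2 * K ≤ τ * (|L| / 2) := by
    have : K ≤ max |K| 1 := (le_abs_self K).trans (le_max_left _ _)
    nlinarith
  rcases le_total 0 L with h0 | h0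
  · have := h (-τ) (by rwa [abs_neg, abs_of_pos hτ0])
    rw [abs_of_nonneg h0] at hK hL'
    nlinarith [mul_pos hτ0 hL']
  · have := h τ (by rwa [abs_of_pos hτ0])
    rw [abs_of_nonpos h0] at hK hL'
    nlinarith [mul_pos hτ0 hL']

lemma integral_exp_pos {V w : Plane → ℝ} (hV : ∀ x, 0 ≤ V x) {S : Set Plane} (hS : S.Finite)
    (hpos : ∀ x ∉ S, 0 < V x) (hi : Integrable fun x => V x * Real.exp (w x)) :
    0 < ∫ x, V x * Real.exp (w x) := by
  rw [integral_pos_iff_support_of_nonneg (fun x => mul_nonneg (hV x) (Real.exp_pos _).le) hi]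
  have : Sᶜ ⊆ Function.support fun x => V x * Real.exp (w x) := fun x hx =>
    (mul_pos (hpos x hx) (Real.exp_pos _)).ne'
  refine lt_of_lt_of_le ?_ (measure_mono this)
  rw [measure_compl hS.measurableSet (by simp [hS.measure_zero]), hS.measure_zero]
  simp

namespace Problem

variable {P : Problem}

lemma Feasible.energy_perturb {ξ ζ φ ψ : Plane → ℝ} {W₁ W₂ : Plane → Plane}
    (h : P.Feasible ξ W₁ ζ W₂) (hφ : MemH P.h₀ φ) (hψ : MemH P.h₀ ψ) (t s r : ℝ) :
    P.energy (fun x => ξ x + t * φ x + s) (fun x => W₁ x + t • gradient φ x)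
        (fun x => ζ x + t * ψ x + r) (fun x => W₂ x + t • gradient ψ x)
      = P.energy ξ W₁ ζ W₂
        + t * ((∫ x, fderiv ℝ φ x (W₁ x)) + 2 * P.c * (∫ x, fderiv ℝ ψ x (W₂ x))
          + (∫ x, φ x * P.f x) + P.σ * ∫ x, ψ x * P.h x)
        + t ^ 2 * (1 / 2 * (∫ x, ‖gradient φ x‖ ^ 2) + P.c * ∫ x, ‖gradient ψ x‖ ^ 2)
        + (s * (∫ x, P.f x) + P.σ * (r * ∫ x, P.h x)) := by
  have key : ∀ (u φ g : Plane → ℝ) (s : ℝ), LocallyIntegrable u → Continuous φ → Continuous g →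
      HasCompactSupport g → ∫ x, (u x + t * φ x + s) * g x
        = (∫ x, u x * g x) + t * (∫ x, φ x * g x) + s * ∫ x, g x := by
    intro u φ g s hu hφ hg hgs
    have i1 := integrable_mul_of_hasCompactSupport hu hg hgs
    have i2 := integrable_mul_of_hasCompactSupport hφ.locallyIntegrable hg hgs
    have i3 : Integrable g := hg.integrable_of_hasCompactSupport hgs
    rw [← integral_const_mul, ← integral_const_mul,
      ← integral_add_add i1 (i2.const_mul t) (i3.const_mul s)]
    refine integral_congr_ae (Eventually.of_forall fun x => ?_)
    simp only
    ring
  rw [energy, energy, integral_norm_sq_perturb h.left.memLp_grad hφ.memLp_gradient,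
    integral_norm_sq_perturb h.right.memLp_grad hψ.memLp_gradient,
    key _ _ _ _ (P.weight.locallyIntegrable h.left.memLp) hφ.1.continuous P.continuous_f
      P.hasCompactSupport_f,
    key _ _ _ _ (P.weight.locallyIntegrable h.right.memLp) hψ.1.continuous P.continuous_h
      P.hasCompactSupport_h]
  ring

theorem euler_lagrange {ξ ζ : Plane → ℝ} {W₁ W₂ : Plane → Plane} (h : P.Feasible ξ W₁ ζ W₂)
    (hmin : ∀ ξ' W₁' ζ' W₂', P.Feasible ξ' W₁' ζ' W₂' →
      P.energy ξ W₁ ζ W₂ ≤ P.energy ξ' W₁' ζ' W₂') :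
    ∃ lam > 0, ∃ rho > 0, ∀ φ ψ : Plane → ℝ, ContDiff ℝ 1 φ → HasCompactSupport φ →
      ContDiff ℝ 1 ψ → HasCompactSupport ψ →
      (∫ x, fderiv ℝ φ x (W₁ x)) + 2 * P.c * (∫ x, fderiv ℝ ψ x (W₂ x))
        + (∫ x, φ x * P.f x) + P.σ * (∫ x, ψ x * P.h x)
        + 2 * lam * (∫ x, P.V x * Real.exp ((ξ x - ζ x) / 2) * ((φ x - ψ x) / 2))
        - rho * (∫ x, P.U x * Real.exp (-P.γ * ζ x) * ψ x) = 0 := by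
  obtain ⟨SU, hSU, hU⟩ := P.exists_finite_U
  obtain ⟨SV, hSV, hV⟩ := P.exists_finite_V
  have iV := h.integrable_V
  have iU := h.integrable_U
  have mV0 : ∀ x, 0 ≤ P.V x * Real.exp ((ξ x - ζ x) / 2) := fun x =>
    mul_nonneg (P.V_nonneg x) (Real.exp_pos _).le
  have mU0 : ∀ x, 0 ≤ P.U x * Real.exp (-P.γ * ζ x) := fun x =>
    mul_nonneg (P.U_nonneg x) (Real.exp_pos _).le
  have leV := (expMass_le_iff P.V_nonneg iV P.a_pos.le).1 h.expMass_V
  have leU := (expMass_le_iff P.U_nonneg iU P.b_pos.le).1 h.expMass_U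
  have ha0 := integral_exp_pos P.V_nonneg hSV hV iV
  have hb0 := integral_exp_pos P.U_nonneg hSU hU iU
  set a₀ := ∫ x, P.V x * Real.exp ((ξ x - ζ x) / 2) with ha₀
  set b₀ := ∫ x, P.U x * Real.exp (-P.γ * ζ x) with hb₀
  have hF := P.integral_f_neg
  have hG := P.integral_add_pos
  have hγ := P.γ_pos
  set F := ∫ x, P.f x with hFdef
  set H := ∫ x, P.h x with hHdef
  refine ⟨-F / a₀, div_pos (neg_pos.2 hF) ha0, (F + P.σ * H) / b₀, div_pos hG hb0,
    fun φ ψ hφ hφs hψ hψs => ?_⟩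
  have Hφ := memH_of_hasCompactSupport P.weight hφ hφs
  have Hψ := memH_of_hasCompactSupport P.weight hψ hψs
  obtain ⟨M1, hM1⟩ := hφs.exists_bound_of_continuous hφ.continuous
  obtain ⟨M2, hM2⟩ := hψs.exists_bound_of_continuous hψ.continuous
  have hM10 : 0 ≤ M1 := (norm_nonneg _).trans (hM1 0)
  have hM20 : 0 ≤ M2 := (norm_nonneg _).trans (hM2 0)
  set M := M1 + M2 + P.γ * M2 + 1 with hMdef
  have hM0 : 0 < M := by positivity
  have bη : ∀ x, |(φ x - ψ x) / 2| ≤ M := fun x => by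
    have e1 := abs_le.1 (hM1 x)
    have e2 := abs_le.1 (hM2 x)
    have e3 : 0 ≤ P.γ * M2 := by positivity
    rw [abs_le]; constructor <;> linarith
  have bψ : ∀ x, |-P.γ * ψ x| ≤ M := fun x => by
    have e2 := hM2 x
    rw [Real.norm_eq_abs] at e2
    rw [abs_mul, abs_neg, abs_of_pos hγ]
    linarith [mul_le_mul_of_nonneg_left e2 hγ.le]
  have hL := eq_zero_of_quadratic_nonneg (δ := 1 / M) (L := (∫ x, fderiv ℝ φ x (W₁ x))
      + 2 * P.c * (∫ x, fderiv ℝ ψ x (W₂ x)) + (∫ x, φ x * P.f x) + P.σ * (∫ x, ψ x * P.h x)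
      + 2 * (-F / a₀) * (∫ x, P.V x * Real.exp ((ξ x - ζ x) / 2) * ((φ x - ψ x) / 2))
      - (F + P.σ * H) / b₀ * (∫ x, P.U x * Real.exp (-P.γ * ζ x) * ψ x))
    (K := (1 / 2 * (∫ x, ‖gradient φ x‖ ^ 2) + P.c * ∫ x, ‖gradient ψ x‖ ^ 2)
      + 2 * (-F) * M ^ 2 + (F + P.σ * H) / P.γ * M ^ 2) (by positivity) ?_
  · exact hL
  intro t ht
  rw [le_div_iff₀ hM0] at ht
  obtain ⟨jV, kV⟩ := exp_mass_perturb iV mV0 (η := fun x => (φ x - ψ x) / 2)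
    ((hφ.continuous.sub hψ.continuous).div_const 2) bη ht
  rw [← ha₀] at kV
  obtain ⟨jU, kU⟩ := exp_mass_perturb iU mU0 (hψ.continuous.const_mul (-P.γ)) bψ ht
  rw [← hb₀] at kU
  have pV : 0 < ∫ x, P.V x * Real.exp ((ξ x - ζ x) / 2) * Real.exp (t * ((φ x - ψ x) / 2)) := by
    simp_rw [mul_assoc, ← Real.exp_add] at jV ⊢
    exact integral_exp_pos P.V_nonneg hSV hV jV
  have pU : 0 < ∫ x, P.U x * Real.exp (-P.γ * ζ x) * Real.exp (t * (-P.γ * ψ x)) := by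
    simp_rw [mul_assoc, ← Real.exp_add, ← mul_assoc] at jU ⊢
    exact integral_exp_pos P.U_nonneg hSU hU jU
  set a₁ := ∫ x, P.V x * Real.exp ((ξ x - ζ x) / 2) * Real.exp (t * ((φ x - ψ x) / 2)) with ha₁
  set b₁ := ∫ x, P.U x * Real.exp (-P.γ * ζ x) * Real.exp (t * (-P.γ * ψ x)) with hb₁
  set r := 1 / P.γ * Real.log (b₁ / b₀) with hr
  set s := r - 2 * Real.log (a₁ / a₀) with hs
  have eV : ∀ x, P.V x * Real.exp ((ξ x + t * φ x + s - (ζ x + t * ψ x + r)) / 2)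
      = P.V x * Real.exp ((ξ x - ζ x) / 2) * Real.exp (t * ((φ x - ψ x) / 2)) * (a₀ / a₁) := by
    intro x
    have e1 : (ξ x + t * φ x + s - (ζ x + t * ψ x + r)) / 2
        = (ξ x - ζ x) / 2 + t * ((φ x - ψ x) / 2) + -Real.log (a₁ / a₀) := by rw [hs]; ring
    rw [e1, Real.exp_add, Real.exp_add, ← Real.log_inv, Real.exp_log (by positivity), inv_div]
    ring
  have eU : ∀ x, P.U x * Real.exp (-P.γ * (ζ x + t * ψ x + r))
      = P.U x * Real.exp (-P.γ * ζ x) * Real.exp (t * (-P.γ * ψ x)) * (b₀ / b₁) := by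
    intro x
    have e1 : -P.γ * (ζ x + t * ψ x + r)
        = -P.γ * ζ x + t * (-P.γ * ψ x) + -Real.log (b₁ / b₀) := by rw [hr]; field_simp; ring
    rw [e1, Real.exp_add, Real.exp_add, ← Real.log_inv, Real.exp_log (by positivity), inv_div]
    ring
  have hfe : P.Feasible (fun x => ξ x + t * φ x + s) (fun x => W₁ x + t • gradient φ x)
      (fun x => ζ x + t * ψ x + r) (fun x => W₂ x + t • gradient ψ x) := by
    refine ⟨h.left.perturb P.weight Hφ t s, h.right.perturb P.weight Hψ t r, ?_, ?_⟩
    · refine expMass_le_of_integral_le P.V_nonneg ?_ ?_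
      · simp_rw [eV]; exact jV.mul_const _
      · simp_rw [eV]
        rw [integral_mul_const, ← ha₁, mul_div_cancel₀ _ pV.ne']
        exact leV
    · refine expMass_le_of_integral_le P.U_nonneg ?_ ?_
      · simp_rw [eU]; exact jU.mul_const _
      · simp_rw [eU]
        rw [integral_mul_const, ← hb₁, mul_div_cancel₀ _ pU.ne']
        exact leU
  have hle := hmin _ _ _ _ hfe
  rw [h.energy_perturb Hφ Hψ] at hle
  have l1 : Real.log (a₁ / a₀) ≤ a₁ / a₀ - 1 := Real.log_le_sub_one_of_pos (by positivity)
  have l2 : Real.log (b₁ / b₀) ≤ b₁ / b₀ - 1 := Real.log_le_sub_one_of_pos (by positivity)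
  have n1 : a₁ / a₀ - 1 ≤ t * ((∫ x, P.V x * Real.exp ((ξ x - ζ x) / 2) * ((φ x - ψ x) / 2)) / a₀)
      + t ^ 2 * M ^ 2 := by
    rw [div_sub_one ha0.ne', div_le_iff₀ ha0, add_mul, mul_assoc, div_mul_cancel₀ _ ha0.ne']
    linarith only [kV]
  have n2 : b₁ / b₀ - 1 ≤ t * ((∫ x, P.U x * Real.exp (-P.γ * ζ x) * (-P.γ * ψ x)) / b₀)
      + t ^ 2 * M ^ 2 := by
    rw [div_sub_one hb0.ne', div_le_iff₀ hb0, add_mul, mul_assoc, div_mul_cancel₀ _ hb0.ne']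
    linarith only [kU]
  have n3 : ∫ x, P.U x * Real.exp (-P.γ * ζ x) * (-P.γ * ψ x)
      = -P.γ * ∫ x, P.U x * Real.exp (-P.γ * ζ x) * ψ x := by
    rw [← integral_const_mul]
    exact integral_congr_ae (Eventually.of_forall fun x => by ring)
  rw [n3] at n2
  have m1 := mul_le_mul_of_nonneg_left (l1.trans n1) (show 0 ≤ 2 * (-F) by linarith only [hF])
  have m2 := mul_le_mul_of_nonneg_left (l2.trans n2)
    (show 0 ≤ (F + P.σ * H) / P.γ by positivity)
  have hsr : s * F + P.σ * (r * H)
      = 2 * (-F) * Real.log (a₁ / a₀) + (F + P.σ * H) / P.γ * Real.log (b₁ / b₀) := by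
    rw [hs, hr]; ring
  rw [hsr] at hle
  have g1 : ∀ B : ℝ, (F + P.σ * H) / P.γ * (t * (-P.γ * B / b₀) + t ^ 2 * M ^ 2)
      = -t * ((F + P.σ * H) / b₀ * B) + t ^ 2 * ((F + P.σ * H) / P.γ * M ^ 2) := fun B => by
    field_simp
  have g2 : ∀ A : ℝ, 2 * (-F) * (t * (A / a₀) + t ^ 2 * M ^ 2)
      = t * (2 * (-F / a₀) * A) + t ^ 2 * (2 * (-F) * M ^ 2) := fun A => by ring
  rw [g1] at m2
  rw [g2] at m1
  linarith only [hle, m1, m2]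

end Problem

/-- `u` has weak gradient `W`, and `W` has weak divergence `G`. -/
structure WeakPoisson (u : Plane → ℝ) (W : Plane → Plane) (G : Plane → ℝ) : Prop where
  locallyIntegrable : LocallyIntegrable u
  locallyIntegrable_grad : LocallyIntegrable W
  locallyIntegrable_source : LocallyIntegrable G
  isWeakGrad : IsWeakGrad u W
  integral_eq : ∀ φ : Plane → ℝ, ContDiff ℝ 1 φ → HasCompactSupport φ →
    ∫ x, fderiv ℝ φ x (W x) = -∫ x, φ x * G x

namespace DyadicKernel

variable (K : DyadicKernel)

lemma pot_nonpos (j : ℕ) (x : Plane) : K.pot j x ≤ 0 := K.Φ_nonpos _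

/-- The contribution of the source `G` at scale `j`. -/
def potConv (G : Plane → ℝ) (j : ℕ) (x : Plane) : ℝ := ∫ y, G y * K.pot j (x - y)

lemma contDiff_pot_one (j : ℕ) : ContDiff ℝ 1 (K.pot j) := (K.contDiff_pot j).of_le (by simp)

lemma contDiff_potConv {G : Plane → ℝ} (hG : LocallyIntegrable G) (j : ℕ) :
    ContDiff ℝ 1 (K.potConv G j) :=
  contDiff_conv hG (K.contDiff_pot_one j) (K.hasCompactSupport_pot j)

lemma integrable_mul_pot {G : Plane → ℝ} (hG : LocallyIntegrable G) (j : ℕ) (x : Plane) :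
    Integrable fun y => G y * K.pot j (x - y) :=
  integrable_mul_of_hasCompactSupport hG
    ((K.contDiff_pot j).continuous.comp (continuous_const.sub continuous_id))
    (hasCompactSupport_comp_sub (K.hasCompactSupport_pot j) x)

lemma integrable_norm_pot_comp_sub (j : ℕ) (x : Plane) : Integrable fun y => ‖K.pot j (x - y)‖ := by
  simpa using (K.integrable_mul_pot (G := fun _ => 1) (locallyIntegrable_const 1) j x).norm

lemma integral_norm_pot_comp_sub (j : ℕ) (x : Plane) :
    ∫ y, ‖K.pot j (x - y)‖ = (1 / 4) ^ j * ∫ z, ‖K.Φ z‖ := by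
  rw [integral_sub_left_eq_self fun z => ‖K.pot j z‖, integral_norm_pot]

lemma potConv_le {G : Plane → ℝ} (hG : LocallyIntegrable G) {m : ℝ}
    (hm : ∀ᵐ y, -m ≤ G y) (j : ℕ) (x : Plane) :
    K.potConv G j x ≤ m * ((1 / 4) ^ j * ∫ z, ‖K.Φ z‖) := by
  rw [← K.integral_norm_pot_comp_sub j x, ← integral_const_mul]
  refine integral_mono_ae (K.integrable_mul_pot hG j x)
    ((K.integrable_norm_pot_comp_sub j x).const_mul m) ?_
  filter_upwards [hm] with y hy
  have := K.pot_nonpos j (x - y)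
  simp only [Real.norm_eq_abs, abs_of_nonpos this]
  nlinarith

lemma norm_potConv_le {G : Plane → ℝ} {M : ℝ} (hM : ∀ᵐ y, |G y| ≤ M) (j : ℕ) (x : Plane) :
    ‖K.potConv G j x‖ ≤ M * ((1 / 4) ^ j * ∫ z, ‖K.Φ z‖) := by
  rw [← K.integral_norm_pot_comp_sub j x, ← integral_const_mul]
  refine norm_integral_le_of_norm_le ((K.integrable_norm_pot_comp_sub j x).const_mul M) ?_
  filter_upwards [hM] with y hy
  rw [norm_mul]
  exact mul_le_mul_of_nonneg_right hy (norm_nonneg _)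

lemma norm_fderiv_potConv_le {G : Plane → ℝ} (hG : LocallyIntegrable G) {M : ℝ}
    (hM : ∀ᵐ y, |G y| ≤ M) (j : ℕ) (x : Plane) :
    ‖fderiv ℝ (K.potConv G j) x‖ ≤ M * ((1 / 2) ^ j * ∫ z, ‖fderiv ℝ K.Φ z‖) := by
  have h1 : fderiv ℝ (K.potConv G j) x = ∫ y, G y • fderiv ℝ (K.pot j) (x - y) :=
    (hasFDerivAt_conv hG (K.contDiff_pot_one j) (K.hasCompactSupport_pot j) x).fderiv
  have h2 : Integrable fun y => ‖fderiv ℝ (K.pot j) (x - y)‖ :=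
    (K.integrable_norm_fderiv_pot j).norm.comp_sub_left x
  rw [h1, ← integral_norm_fderiv_pot,
    ← integral_sub_left_eq_self (fun z => ‖fderiv ℝ (K.pot j) z‖) volume x,
    ← integral_const_mul]
  refine norm_integral_le_of_norm_le (h2.const_mul M) ?_
  filter_upwards [hM] with y hy
  rw [norm_smul]
  exact mul_le_mul_of_nonneg_right hy (norm_nonneg _)

lemma summable_potConv {G : Plane → ℝ} {M : ℝ} (hM : ∀ᵐ y, |G y| ≤ M) (x : Plane) :
    Summable fun j => K.potConv G j x :=
  Summable.of_norm_bounded (((summable_geometric_of_lt_one (by norm_num) (by norm_num)).mul_right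
    _).mul_left M) fun j => K.norm_potConv_le hM j x

lemma contDiff_tsum_potConv {G : Plane → ℝ} (hG : LocallyIntegrable G) {M : ℝ}
    (hM : ∀ᵐ y, |G y| ≤ M) : ContDiff ℝ 1 fun x => ∑' j, K.potConv G j x := by
  refine contDiff_tsum (N := 1) (v := fun k j => if k = 0 then M * ((1 / 4) ^ j * ∫ z, ‖K.Φ z‖)
    else M * ((1 / 2) ^ j * ∫ z, ‖fderiv ℝ K.Φ z‖)) (fun j => K.contDiff_potConv hG j) ?_ ?_
  · intro k _
    split_ifs
    · exact ((summable_geometric_of_lt_one (by norm_num) (by norm_num)).mul_right _).mul_left M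
    · exact ((summable_geometric_of_lt_one (by norm_num) (by norm_num)).mul_right _).mul_left M
  · intro k j x hk
    have hk' : k ≤ 1 := by exact_mod_cast hk
    interval_cases k
    · rw [norm_iteratedFDeriv_zero]
      exact K.norm_potConv_le hM j x
    · rw [norm_iteratedFDeriv_one]
      exact K.norm_fderiv_potConv_le hG hM j x

lemma potConv_congr {G G' : Plane → ℝ} {R : ℝ} (h : ∀ y, ‖y‖ ≤ R + 1 → G y = G' y) (j : ℕ)
    {x : Plane} (hx : ‖x‖ ≤ R) : K.potConv G j x = K.potConv G' j x := by
  refine integral_congr_ae (Eventually.of_forall fun y => ?_)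
  simp only
  rcases le_total 1 ‖x - y‖ with h1 | h1
  · rw [K.pot_eq_zero j h1, mul_zero, mul_zero]
  · rw [h y]
    have := norm_sub_norm_le y x
    rw [norm_sub_rev] at this
    linarith

end DyadicKernel

namespace WeakPoisson

variable {u : Plane → ℝ} {W : Plane → Plane} {G : Plane → ℝ} (h : WeakPoisson u W G)
include h

lemma neg : WeakPoisson (fun x => -u x) (fun x => -W x) (fun x => -G x) where
  locallyIntegrable := h.locallyIntegrable.neg
  locallyIntegrable_grad := h.locallyIntegrable_grad.neg
  locallyIntegrable_source := h.locallyIntegrable_source.neg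
  isWeakGrad := by
    simpa using h.isWeakGrad.linear_comb h.locallyIntegrable h.locallyIntegrable
      h.locallyIntegrable_grad h.locallyIntegrable_grad h.isWeakGrad (-1) 0
  integral_eq φ hφ hφs := by
    simp only [map_neg, mul_neg, integral_neg, h.integral_eq φ hφ hφs]

lemma ae_tendsto (K : DyadicKernel) : ∀ᵐ x, Tendsto (fun n => (∫ y, u y * K.dens 0 (x - y))
    + ∑ j ∈ Finset.range n, K.potConv G j x) atTop (𝓝 (u x)) := by
  filter_upwards [K.ae_tendsto_conv_dens h.locallyIntegrable] with x hx
  refine hx.congr fun n => ?_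
  rw [K.conv_dens_eq_sum h.locallyIntegrable h.locallyIntegrable_grad h.isWeakGrad]
  congr 1
  refine Finset.sum_congr rfl fun j _ => ?_
  have := h.integral_eq (fun y => K.pot j (x - y))
    ((K.contDiff_pot_one j).comp (contDiff_const.sub contDiff_id))
    (hasCompactSupport_comp_sub (K.hasCompactSupport_pot j) x)
  simp only [fderiv_apply_comp_sub, integral_neg, neg_inj] at this
  rw [this, DyadicKernel.potConv]
  simp only [mul_comm]

/-- Subsolutions are locally bounded above. -/
lemma exists_le_of_source_ge {m : ℝ} (hm0 : 0 ≤ m) (hm : ∀ᵐ x, -m ≤ G x) (R : ℝ) :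
    ∃ C : ℝ, ∀ᵐ x, ‖x‖ ≤ R → u x ≤ C := by
  obtain ⟨K⟩ := DyadicKernel.nonempty
  have hc : Continuous fun x => ∫ y, u y * K.dens 0 (x - y) :=
    (contDiff_conv h.locallyIntegrable ((K.contDiff_dens 0).of_le (by simp))
      (K.hasCompactSupport_dens 0)).continuous
  obtain ⟨C, hC⟩ := (isCompact_closedBall (0 : Plane) R).exists_bound_of_continuousOn hc.continuousOn
  have hsum : Summable fun j : ℕ => m * ((1 / 4 : ℝ) ^ j * ∫ z, ‖K.Φ z‖) :=
    ((summable_geometric_of_lt_one (by norm_num) (by norm_num)).mul_right _).mul_left m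
  refine ⟨C + ∑' j : ℕ, m * ((1 / 4 : ℝ) ^ j * ∫ z, ‖K.Φ z‖), ?_⟩
  filter_upwards [h.ae_tendsto K] with x hx hxR
  refine le_of_tendsto' hx fun n => add_le_add ?_ ?_
  · exact (le_abs_self _).trans (hC x (by simpa using hxR))
  · refine (Finset.sum_le_sum fun j _ =>
      K.potConv_le h.locallyIntegrable_source hm j x).trans ?_
    exact hsum.sum_le_tsum _ fun j _ =>
      mul_nonneg hm0 (mul_nonneg (by positivity) (integral_nonneg fun _ => norm_nonneg _))

theorem exists_contDiff (hb : ∀ R : ℝ, ∃ M : ℝ, ∀ᵐ x, ‖x‖ ≤ R → |G x| ≤ M) :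
    ∃ v : Plane → ℝ, ContDiff ℝ 1 v ∧ v =ᵐ[volume] u := by
  obtain ⟨K⟩ := DyadicKernel.nonempty
  have trunc : ∀ R : ℝ, ∃ (g : Plane → ℝ) (M : ℝ), LocallyIntegrable g ∧ (∀ᵐ y, |g y| ≤ M) ∧
      ∀ y, ‖y‖ ≤ R + 1 → G y = g y := fun R => by
    obtain ⟨M, hM⟩ := hb (R + 1)
    refine ⟨(Metric.closedBall 0 (R + 1)).indicator G, max M 0,
      h.locallyIntegrable_source.indicator measurableSet_closedBall, ?_, fun y hy => ?_⟩
    · filter_upwards [hM] with y hy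
      by_cases hyR : y ∈ Metric.closedBall (0 : Plane) (R + 1)
      · rw [Set.indicator_of_mem hyR]
        exact (hy (by simpa using hyR)).trans (le_max_left _ _)
      · rw [Set.indicator_of_notMem hyR, abs_zero]
        exact le_max_right _ _
    · rw [Set.indicator_of_mem (by simpa using hy)]
  refine ⟨fun x => (∫ y, u y * K.dens 0 (x - y)) + ∑' j, K.potConv G j x, ?_, ?_⟩
  · refine (contDiff_conv h.locallyIntegrable ((K.contDiff_dens 0).of_le (by simp))
      (K.hasCompactSupport_dens 0)).add (contDiff_iff_contDiffAt.2 fun x => ?_)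
    obtain ⟨g, M, hg, hM, hgG⟩ := trunc (‖x‖ + 1)
    refine (K.contDiff_tsum_potConv hg hM).contDiffAt.congr_of_eventuallyEq ?_
    have hnear : ∀ᶠ z in 𝓝 x, ‖z‖ < ‖x‖ + 1 :=
      continuous_norm.continuousAt.eventually_lt continuousAt_const (by simp)
    filter_upwards [hnear] with z hz
    exact tsum_congr fun j => K.potConv_congr hgG j hz.le
  · filter_upwards [h.ae_tendsto K] with x hx
    obtain ⟨g, M, hg, hM, hgG⟩ := trunc ‖x‖
    have hs : Summable fun j => K.potConv G j x :=
      (K.summable_potConv hM x).congr fun j => (K.potConv_congr hgG j le_rfl).symm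
    exact tendsto_nhds_unique (hs.hasSum.tendsto_sum_nat.const_add _) hx

end WeakPoisson

lemma exists_abs_le_of_continuous {g : Plane → ℝ} (hg : Continuous g) (R : ℝ) :
    ∃ M : ℝ, 0 ≤ M ∧ ∀ x, ‖x‖ ≤ R → |g x| ≤ M := by
  obtain ⟨M, hM⟩ := (isCompact_closedBall (0 : Plane) R).exists_bound_of_continuousOn hg.continuousOn
  exact ⟨max M 0, le_max_right _ _, fun x hx => (hM x (by simpa using hx)).trans (le_max_left _ _)⟩

lemma mul_exp_le {v w M C : ℝ} (hM : |v| ≤ M) (hw : w ≤ C) :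
    v * Real.exp w ≤ M * Real.exp C :=
  mul_le_mul ((le_abs_self v).trans hM) (Real.exp_le_exp.2 hw) (Real.exp_pos _).le
    ((abs_nonneg v).trans hM)

namespace Problem

variable (P : Problem)

/-- The relaxed problem has a minimizer of class `C¹`. -/
theorem exists_memH_minimizer : ∃ ξ ζ : Plane → ℝ, MemH P.h₀ ξ ∧ MemH P.h₀ ζ ∧
    P.Feasible ξ (gradient ξ) ζ (gradient ζ) ∧ ∀ ξ' W₁' ζ' W₂', P.Feasible ξ' W₁' ζ' W₂' →
      P.energy ξ (gradient ξ) ζ (gradient ζ) ≤ P.energy ξ' W₁' ζ' W₂' := by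
  obtain ⟨ξ, W₁, ζ, W₂, hF, hmin⟩ := P.exists_minimizer
  obtain ⟨lam, hlam, rho, hrho, EL⟩ := euler_lagrange hF hmin
  have iV := hF.integrable_V
  have iU := hF.integrable_U
  have hc := P.c_pos
  have hγ := P.γ_pos
  have Vnn : ∀ x, 0 ≤ P.V x * Real.exp ((ξ x - ζ x) / 2) := fun x =>
    mul_nonneg (P.V_nonneg x) (Real.exp_pos _).le
  have Unn : ∀ x, 0 ≤ P.U x * Real.exp (-P.γ * ζ x) := fun x =>
    mul_nonneg (P.U_nonneg x) (Real.exp_pos _).le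
  have lf := P.continuous_f.locallyIntegrable (μ := volume)
  have lh := P.continuous_h.locallyIntegrable (μ := volume)
  have lV := iV.locallyIntegrable
  have lU := iU.locallyIntegrable
  set eV : Plane → ℝ := fun x => P.V x * Real.exp ((ξ x - ζ x) / 2) with heV
  set eU : Plane → ℝ := fun x => P.U x * Real.exp (-P.γ * ζ x) with heU
  have w1 : WeakPoisson ξ W₁ (fun x => P.f x + lam * eV x) := by
    refine ⟨P.weight.locallyIntegrable hF.left.memLp, hF.left.memLp_grad.locallyIntegrable one_le_two,
      lf.add (lV.smul lam), hF.left.isWeakGrad, fun φ hφ hφs => ?_⟩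
    have i1 := integrable_mul_of_hasCompactSupport lf hφ.continuous hφs
    have i2 := integrable_mul_of_hasCompactSupport lV hφ.continuous hφs
    have e := EL φ (fun _ => 0) hφ hφs contDiff_const (HasCompactSupport.zero)
    have e1 : ∫ x, φ x * (P.f x + lam * eV x) = (∫ x, φ x * P.f x) + lam * ∫ x, eV x * φ x := by
      rw [← integral_const_mul, ← integral_add (by simpa only [mul_comm] using i1) (i2.const_mul lam)]
      exact integral_congr_ae (Eventually.of_forall fun x => by simp only; ring)
    have e2 : ∫ x, eV x * ((φ x - 0) / 2) = 1 / 2 * ∫ x, eV x * φ x := by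
      rw [← integral_const_mul]
      exact integral_congr_ae (Eventually.of_forall fun x => by simp only; ring)
    change _ + _ + _ + _ + 2 * lam * (∫ x, eV x * ((φ x - 0) / 2)) - _ = 0 at e
    rw [e2] at e
    simp only [fderiv_fun_const, Pi.zero_apply, zero_apply, integral_zero,
      mul_zero, zero_mul, add_zero, sub_zero] at e
    rw [e1]
    linarith only [e]
  have w2 : WeakPoisson ζ W₂
      (fun x => (1 / (2 * P.c)) * (P.σ * P.h x - lam * eV x - rho * eU x)) := by
    refine ⟨P.weight.locallyIntegrable hF.right.memLp,
      hF.right.memLp_grad.locallyIntegrable one_le_two,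
      (((lh.smul P.σ).sub (lV.smul lam)).sub (lU.smul rho)).smul (1 / (2 * P.c)),
      hF.right.isWeakGrad, fun ψ hψ hψs => ?_⟩
    have i1 := integrable_mul_of_hasCompactSupport lh hψ.continuous hψs
    have i2 := integrable_mul_of_hasCompactSupport lV hψ.continuous hψs
    have i3 := integrable_mul_of_hasCompactSupport lU hψ.continuous hψs
    have e := EL (fun _ => 0) ψ contDiff_const (HasCompactSupport.zero) hψ hψs
    have e1 : ∫ x, ψ x * ((1 / (2 * P.c)) * (P.σ * P.h x - lam * eV x - rho * eU x))
        = 1 / (2 * P.c) * (P.σ * (∫ x, ψ x * P.h x) + -lam * (∫ x, eV x * ψ x)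
          + -rho * ∫ x, eU x * ψ x) := by
      simp only [mul_comm (ψ _) (P.h _)]
      rw [← integral_const_mul, ← integral_const_mul, ← integral_const_mul,
        ← integral_add_add (i1.const_mul _) (i2.const_mul _) (i3.const_mul _), ← integral_const_mul]
      exact integral_congr_ae (Eventually.of_forall fun x => by simp only; ring)
    have e2 : ∫ x, eV x * ((0 - ψ x) / 2) = -(1 / 2) * ∫ x, eV x * ψ x := by
      rw [← integral_const_mul]
      exact integral_congr_ae (Eventually.of_forall fun x => by simp only; ring)
    change _ + _ + _ + _ + 2 * lam * (∫ x, eV x * ((0 - ψ x) / 2)) - rho * (∫ x, eU x * ψ x) = 0 at e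
    rw [e2] at e
    simp only [fderiv_fun_const, Pi.zero_apply, zero_apply, integral_zero,
      zero_mul, add_zero, zero_add] at e
    rw [e1]
    field_simp
    linarith only [e]
  have up1 : ∀ R, ∃ C : ℝ, ∀ᵐ x, ‖x‖ ≤ R → ξ x ≤ C := by
    obtain ⟨M, hM⟩ := P.hasCompactSupport_f.exists_bound_of_continuous P.continuous_f
    refine w1.exists_le_of_source_ge ((norm_nonneg _).trans (hM 0))
      (Eventually.of_forall fun x => ?_)
    have := (abs_le.1 (hM x)).1
    have : 0 ≤ lam * eV x := mul_nonneg hlam.le (Vnn x)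
    linarith
  have up2 : ∀ R, ∃ C : ℝ, ∀ᵐ x, ‖x‖ ≤ R → -ζ x ≤ C := by
    obtain ⟨M, hM⟩ := P.hasCompactSupport_h.exists_bound_of_continuous P.continuous_h
    have hM0 := (norm_nonneg _).trans (hM 0)
    refine w2.neg.exists_le_of_source_ge (m := 1 / (2 * P.c) * (|P.σ| * M)) (by positivity)
      (Eventually.of_forall fun x => ?_)
    have h1 : P.σ * P.h x ≤ |P.σ| * M := (le_abs_self _).trans (by
      rw [abs_mul]; exact mul_le_mul_of_nonneg_left (hM x) (abs_nonneg _))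
    have h2 : 0 ≤ lam * eV x := mul_nonneg hlam.le (Vnn x)
    have h3 : 0 ≤ rho * eU x := mul_nonneg hrho.le (Unn x)
    rw [neg_le_neg_iff]
    refine mul_le_mul_of_nonneg_left ?_ (by positivity)
    linarith
  have bV : ∀ R, ∃ M : ℝ, ∀ᵐ x, ‖x‖ ≤ R → eV x ≤ M := fun R => by
    obtain ⟨C1, h1⟩ := up1 R
    obtain ⟨C2, h2⟩ := up2 R
    obtain ⟨M, -, hM⟩ := exists_abs_le_of_continuous P.continuous_V R
    refine ⟨M * Real.exp ((C1 + C2) / 2), ?_⟩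
    filter_upwards [h1, h2] with x h1 h2 hx
    exact mul_exp_le (hM x hx) (by linarith [h1 hx, h2 hx])
  have bU : ∀ R, ∃ M : ℝ, ∀ᵐ x, ‖x‖ ≤ R → eU x ≤ M := fun R => by
    obtain ⟨C2, h2⟩ := up2 R
    obtain ⟨M, -, hM⟩ := exists_abs_le_of_continuous P.continuous_U R
    refine ⟨M * Real.exp (P.γ * C2), ?_⟩
    filter_upwards [h2] with x h2 hx
    exact mul_exp_le (hM x hx) (by nlinarith [mul_le_mul_of_nonneg_left (h2 hx) hγ.le])
  obtain ⟨ξ', hξ', eξ⟩ := w1.exists_contDiff fun R => by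
    obtain ⟨A, hA⟩ := bV R
    obtain ⟨B, hB0, hB⟩ := exists_abs_le_of_continuous P.continuous_f R
    refine ⟨B + lam * A, ?_⟩
    filter_upwards [hA] with x hA hx
    refine (abs_add_le _ _).trans (add_le_add (hB x hx) ?_)
    rw [abs_of_nonneg (mul_nonneg hlam.le (Vnn x))]
    exact mul_le_mul_of_nonneg_left (hA hx) hlam.le
  obtain ⟨ζ', hζ', eζ⟩ := w2.exists_contDiff fun R => by
    obtain ⟨A, hA⟩ := bV R
    obtain ⟨D, hD⟩ := bU R
    obtain ⟨B, hB0, hB⟩ := exists_abs_le_of_continuous P.continuous_h R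
    refine ⟨1 / (2 * P.c) * (|P.σ| * B + lam * A + rho * D), ?_⟩
    filter_upwards [hA, hD] with x hA hD hx
    rw [abs_mul, abs_of_pos (a := 1 / (2 * P.c)) (by positivity)]
    refine mul_le_mul_of_nonneg_left ?_ (by positivity)
    refine (abs_sub _ _).trans (add_le_add ((abs_sub _ _).trans (add_le_add ?_ ?_)) ?_)
    · rw [abs_mul]
      exact mul_le_mul_of_nonneg_left (hB x hx) (abs_nonneg _)
    · rw [abs_of_nonneg (mul_nonneg hlam.le (Vnn x))]
      exact mul_le_mul_of_nonneg_left (hA hx) hlam.le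
    · rw [abs_of_nonneg (mul_nonneg hrho.le (Unn x))]
      exact mul_le_mul_of_nonneg_left (hD hx) hrho.le
  obtain ⟨m1, g1⟩ := memH_of_ae_eq hξ' hF.left.memLp hF.left.memLp_grad hF.left.isWeakGrad eξ
  obtain ⟨m2, g2⟩ := memH_of_ae_eq hζ' hF.right.memLp hF.right.memLp_grad hF.right.isWeakGrad eζ
  refine ⟨ξ', ζ', m1, m2, hF.congr eξ.symm g1.symm eζ.symm g2.symm, fun _ _ _ _ h => ?_⟩
  rw [← P.energy_congr eξ.symm g1.symm eζ.symm g2.symm]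
  exact hmin _ _ _ _ h

end Problem

lemma gradient_add_const (u : Plane → ℝ) (s : ℝ) : gradient (fun x => u x + s) = gradient u := by
  funext x
  rw [gradient, gradient, fderiv_add_const]

lemma MemH.add_const {h₀ u : Plane → ℝ} (hw : IsWeight h₀) (hu : MemH h₀ u) (s : ℝ) :
    MemH h₀ fun x => u x + s := by
  have := hw.isFiniteMeasure
  refine ⟨hu.1.add_const s, ?_, (hu.memLp.add (memLp_const s)).integrable_sq⟩
  rw [gradient_add_const]
  exact hu.2.1

lemma integrable_of_le_exp_neg_norm {U : Plane → ℝ} (hU : Continuous U) (hn : ∀ x, 0 ≤ U x) {C : ℝ}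
    (hle : ∀ x, U x ≤ C * Real.exp (-‖x‖)) : Integrable U := by
  have hC : 0 ≤ C := by
    have := (hn 0).trans (hle 0)
    simpa using this
  have hi : Integrable fun x : Plane => C * (6 * (1 + ‖x‖) ^ (-(3 : ℝ))) :=
    ((integrable_one_add_norm (by simp; norm_num)).const_mul _).const_mul _
  refine hi.mono' hU.aestronglyMeasurable (Eventually.of_forall fun x => ?_)
  rw [Real.norm_eq_abs, abs_of_nonneg (hn x)]
  refine (hle x).trans (mul_le_mul_of_nonneg_left ?_ hC)
  have hx : 0 < 1 + ‖x‖ := by positivity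
  have h1 : 1 + ‖x‖ + ‖x‖ ^ 2 / 2 + ‖x‖ ^ 3 / 6 ≤ Real.exp ‖x‖ := by
    have := Real.sum_le_exp_of_nonneg (norm_nonneg x) 4
    simp [Finset.sum_range_succ, Nat.factorial] at this
    linarith
  rw [Real.rpow_neg hx.le, Real.exp_neg, ← div_eq_mul_inv, ← one_div,
    div_le_div_iff₀ (Real.exp_pos _) (by positivity)]
  have : (1 + ‖x‖) ^ (3 : ℝ) = (1 + ‖x‖) ^ 3 := by
    rw [← Real.rpow_natCast]; norm_num
  rw [this]
  nlinarith [norm_nonneg x, sq_nonneg ‖x‖]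

namespace Problem

variable (P : Problem)

/-- The relaxed problem has a `C¹` minimizer for which both constraints are equalities. -/
theorem exists_saturated_minimizer : ∃ ξ ζ : Plane → ℝ, MemH P.h₀ ξ ∧ MemH P.h₀ ζ ∧
    Integrable (fun x => P.V x * Real.exp ((ξ x - ζ x) / 2)) ∧
    Integrable (fun x => P.U x * Real.exp (-P.γ * ζ x)) ∧
    ∫ x, P.V x * Real.exp ((ξ x - ζ x) / 2) = P.a ∧ ∫ x, P.U x * Real.exp (-P.γ * ζ x) = P.b ∧
    ∀ ξ' W₁' ζ' W₂', P.Feasible ξ' W₁' ζ' W₂' →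
      P.energy ξ (gradient ξ) ζ (gradient ζ) ≤ P.energy ξ' W₁' ζ' W₂' := by
  obtain ⟨ξ, ζ, m1, m2, hF, hmin⟩ := P.exists_memH_minimizer
  obtain ⟨SU, hSU, hU⟩ := P.exists_finite_U
  obtain ⟨SV, hSV, hV⟩ := P.exists_finite_V
  have iV := hF.integrable_V
  have iU := hF.integrable_U
  have leV := (expMass_le_iff P.V_nonneg iV P.a_pos.le).1 hF.expMass_V
  have leU := (expMass_le_iff P.U_nonneg iU P.b_pos.le).1 hF.expMass_U
  have ha0 := integral_exp_pos P.V_nonneg hSV hV iV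
  have hb0 := integral_exp_pos P.U_nonneg hSU hU iU
  set a₀ := ∫ x, P.V x * Real.exp ((ξ x - ζ x) / 2) with ha₀
  set b₀ := ∫ x, P.U x * Real.exp (-P.γ * ζ x) with hb₀
  have ha := P.a_pos
  have hb := P.b_pos
  have hγ := P.γ_pos
  set r := -(1 / P.γ * Real.log (P.b / b₀)) with hr
  set s := r + 2 * Real.log (P.a / a₀) with hs
  have eV : ∀ x, P.V x * Real.exp ((ξ x + s - (ζ x + r)) / 2)
      = P.V x * Real.exp ((ξ x - ζ x) / 2) * (P.a / a₀) := fun x => by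
    rw [show (ξ x + s - (ζ x + r)) / 2 = (ξ x - ζ x) / 2 + Real.log (P.a / a₀) by rw [hs]; ring,
      Real.exp_add, Real.exp_log (by positivity), mul_assoc]
  have eU : ∀ x, P.U x * Real.exp (-P.γ * (ζ x + r))
      = P.U x * Real.exp (-P.γ * ζ x) * (P.b / b₀) := fun x => by
    rw [show -P.γ * (ζ x + r) = -P.γ * ζ x + Real.log (P.b / b₀) by rw [hr]; field_simp; ring,
      Real.exp_add, Real.exp_log (by positivity), mul_assoc]
  refine ⟨fun x => ξ x + s, fun x => ζ x + r, m1.add_const P.weight s, m2.add_const P.weight r,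
    ?_, ?_, ?_, ?_, fun ξ' W₁' ζ' W₂' h => le_trans ?_ (hmin _ _ _ _ h)⟩
  · simp_rw [eV]; exact iV.mul_const _
  · simp_rw [eU]; exact iU.mul_const _
  · simp_rw [eV]; rw [integral_mul_const, ← ha₀, mul_div_cancel₀ _ ha0.ne']
  · simp_rw [eU]; rw [integral_mul_const, ← hb₀, mul_div_cancel₀ _ hb0.ne']
  · have e := hF.energy_perturb m1 m2 0 s r
    simp only [zero_mul, add_zero, zero_smul, ne_eq, OfNat.ofNat_ne_zero, not_false_eq_true,
      zero_pow] at e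
    rw [gradient_add_const, gradient_add_const]
    refine e.le.trans ?_
    have l1 : 0 ≤ Real.log (P.a / a₀) := Real.log_nonneg (by rwa [le_div_iff₀ ha0, one_mul])
    have l2 : 0 ≤ 1 / P.γ * Real.log (P.b / b₀) :=
      mul_nonneg (by positivity) (Real.log_nonneg (by rwa [le_div_iff₀ hb0, one_mul]))
    have := mul_nonneg l1 (neg_pos.2 P.integral_f_neg).le
    have := mul_nonneg l2 P.integral_add_pos.le
    rw [hs, hr]
    nlinarith

end Problem

lemma Ifun_eq {h₀ f h ξ ζ : Plane → ℝ} (p q : ℝ) (hf : Continuous f) (hfs : HasCompactSupport f)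
    (hh : Continuous h) (hhs : HasCompactSupport h) (hξ : MemH h₀ ξ) (hζ : MemH h₀ ζ) :
    Ifun p q f h ξ ζ = 1 / 2 * (∫ x, ‖gradient ξ x‖ ^ 2)
      + Kdet p q / (2 * k12 p q ^ 2) * (∫ x, ‖gradient ζ x‖ ^ 2) + (∫ x, ξ x * f x)
      + Kdet p q / k12 p q ^ 2 * ∫ x, ζ x * h x := by
  have i3 := integrable_mul_of_hasCompactSupport hξ.1.continuous.locallyIntegrable hf hfs
  have i4 := integrable_mul_of_hasCompactSupport hζ.1.continuous.locallyIntegrable hh hhs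
  have i12 : Integrable fun x => 1 / 2 * ‖gradient ξ x‖ ^ 2
      + Kdet p q / (2 * k12 p q ^ 2) * ‖gradient ζ x‖ ^ 2 :=
    (hξ.2.1.const_mul (1 / 2)).add (hζ.2.1.const_mul (Kdet p q / (2 * k12 p q ^ 2)))
  rw [← integral_const_mul, ← integral_const_mul, ← integral_const_mul,
    ← integral_add (hξ.2.1.const_mul _) (hζ.2.1.const_mul _),
    ← integral_add_add i12 i3 (i4.const_mul _), Ifun]
  exact integral_congr_ae (Eventually.of_forall fun x => by simp only; ring)

end Auxiliary

/-- Existence of a constrained minimizer of I over 𝒜 in the case 0 < k₁₂ < 1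
(i.e. p > q > 0). -/
theorem constrained_minimizer_k12_pos
    (κ : ℝ) (hκ : 4 < κ) (h₀ : Plane → ℝ)
    (h₀smooth : ContDiff ℝ (⊤ : ℕ∞) h₀) (h₀pos : ∀ x, 0 < h₀ x)
    (h₀eq : ∀ x : Plane, 1 ≤ ‖x‖ → h₀ x = ‖x‖ ^ (-κ))
    (p q : ℝ) (hp : 0 < p) (hq : 0 < q) (hpq : p ≠ q)
    (α β : ℝ)
    (f h : Plane → ℝ)
    (hfcont : Continuous f) (hfsupp : HasCompactSupport f)
    (hhcont : Continuous h) (hhsupp : HasCompactSupport h)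
    (hfint : ∫ x, f x = -(2 * π * α)) (hhint : ∫ x, h x = 2 * π * β)
    (U V : Plane → ℝ)
    (hUcont : Continuous U) (hVcont : Continuous V)
    (hUnn : ∀ x, 0 ≤ U x) (hVnn : ∀ x, 0 ≤ V x)
    (SU SV : Set Plane) (hSU : SU.Finite) (hSV : SV.Finite)
    (hUpos : ∀ x ∉ SU, 0 < U x) (hVpos : ∀ x ∉ SV, 0 < V x)
    (hlogU : Integrable (fun x => Real.log (U x)) (wMeasure h₀))
    (hlogV : Integrable (fun x => Real.log (V x)) (wMeasure h₀))
    (CUV : ℝ) (hCUV : 0 < CUV)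
    (hUbd : ∀ x, U x ≤ CUV * Real.exp (-‖x‖))
    (hVbd : ∀ x, V x ≤ CUV * Real.exp (-‖x‖))
    (hqp : q < p) (hα : 0 < α)
    (hβ : β > α / 4 * (p / q + q / p - 2)) :
    ∃ ξ ζ : Plane → ℝ, Admissible h₀ p q α β U V ξ ζ ∧
      ∀ φ ψ : Plane → ℝ, Admissible h₀ p q α β U V φ ψ →
        Ifun p q f h ξ ζ ≤ Ifun p q f h φ ψ := by
  have hk11 : 0 < k11 p q := div_pos (add_pos hp hq) hp
  have hk12 : 0 < k12 p q := div_pos (sub_pos.2 hqp) hp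
  have hK : 0 < Kdet p q := div_pos (by positivity) hp
  have hβ' : k12 p q ^ 2 / Kdet p q * α < β := by
    have : k12 p q ^ 2 / Kdet p q * α = α / 4 * (p / q + q / p - 2) := by
      rw [k12, Kdet]
      field_simp
      ring
    rw [this]
    exact hβ
  have hconstr : ∀ A B : ℝ, (2 * Kdet p q / k11 p q * A = 2 * π * α ∧
      2 * k12 p q * B + 2 * k12 p q ^ 2 / k11 p q * A = 2 * π * β) ↔
      (A = π * α * k11 p q / Kdet p q ∧
        B = π * (β - k12 p q ^ 2 / Kdet p q * α) / k12 p q) := by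
    intro A B
    have e1 : 2 * Kdet p q / k11 p q * A = 2 * π * α ↔ A = π * α * k11 p q / Kdet p q := by
      rw [eq_div_iff hK.ne', div_mul_eq_mul_div, div_eq_iff hk11.ne']
      constructor <;> intro e <;> linarith
    rw [e1]
    refine and_congr_right fun hA => ?_
    rw [hA, eq_div_iff hk12.ne']
    have e2 : 2 * k12 p q ^ 2 / k11 p q * (π * α * k11 p q / Kdet p q)
        = 2 * (π * (k12 p q ^ 2 / Kdet p q * α)) := by field_simp
    rw [e2]
    constructor <;> intro e <;> linarith
  let P : Problem :=
    { h₀ := h₀, f := f, h := h, U := U, V := V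
      c := Kdet p q / (2 * k12 p q ^ 2)
      σ := Kdet p q / k12 p q ^ 2
      γ := k11 p q / (2 * k12 p q)
      a := π * α * k11 p q / Kdet p q
      b := π * (β - k12 p q ^ 2 / Kdet p q * α) / k12 p q
      weight := isWeight_of_eq_rpow hκ h₀smooth.continuous h₀pos h₀eq
      continuous_f := hfcont
      hasCompactSupport_f := hfsupp
      continuous_h := hhcont
      hasCompactSupport_h := hhsupp
      continuous_U := hUcont
      continuous_V := hVcont
      U_nonneg := hUnn
      V_nonneg := hVnn
      exists_finite_U := ⟨SU, hSU, hUpos⟩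
      exists_finite_V := ⟨SV, hSV, hVpos⟩
      integrable_U := integrable_of_le_exp_neg_norm hUcont hUnn hUbd
      integrable_V := integrable_of_le_exp_neg_norm hVcont hVnn hVbd
      integrable_log_U := hlogU
      integrable_log_V := hlogV
      c_pos := by positivity
      γ_pos := by positivity
      a_pos := by positivity
      b_pos := div_pos (mul_pos pi_pos (sub_pos.2 hβ')) hk12
      integral_f_neg := by
        rw [hfint]
        have := mul_pos pi_pos hα
        linarith
      integral_add_pos := by
        rw [hfint, hhint]
        have e : α < Kdet p q / k12 p q ^ 2 * β := by
          have := mul_lt_mul_of_pos_left hβ' (show 0 < Kdet p q / k12 p q ^ 2 by positivity)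
          have e : Kdet p q / k12 p q ^ 2 * (k12 p q ^ 2 / Kdet p q * α) = α := by field_simp
          rwa [e] at this
        have := mul_lt_mul_of_pos_left e pi_pos
        linarith }
  obtain ⟨ξ, ζ, m1, m2, iV, iU, eV, eU, hmin⟩ := P.exists_saturated_minimizer
  refine ⟨ξ, ζ, ⟨m1, m2, iV, iU, (hconstr _ _).2 ⟨eV, eU⟩⟩, fun φ ψ hφψ => ?_⟩
  obtain ⟨n1, n2, jV, jU, hc⟩ := hφψ
  obtain ⟨cV, cU⟩ := (hconstr _ _).1 hc
  rw [Ifun_eq p q hfcont hfsupp hhcont hhsupp m1 m2, Ifun_eq p q hfcont hfsupp hhcont hhsupp n1 n2]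
  exact hmin φ (gradient φ) ψ (gradient ψ) ⟨n1.weakH, n2.weakH,
    expMass_le_of_integral_le hVnn jV cV.le, expMass_le_of_integral_le hUnn jU cU.le⟩
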